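/- Let n ≥ 1 and p > 0, p ≠ 1, and let v(x,t) be a smooth, rapidly decaying positive solution of the nonlinear diffusion equation ∂v/∂t = Δ(v^p) on ℝⁿ × (0,∞) which is a probability density with finite ∫ v^p dx > 0 and finite generalized Fisher information for every t > 0. Then the Rényi entropy of order p of the solution satisfies the generalized DeBruijn identity d/dt R_p(v(·,t)) = I_p(v(·,t)) for all t > 0; in particular R_p(v(·,t)) is increasing in time. -/

import Mathlib

open MeasureTheory Real Filter
open scoped Topology

noncomputable section

/-- The Rényi entropy of order `p` of a density `f` on `ℝⁿ`:
`R_p(f) = (1/(1-p)) log ∫ f^p`. -/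
def Rp (n : ℕ) (p : ℝ) (f : EuclideanSpace ℝ (Fin n) → ℝ) : ℝ :=
  (1 / (1 - p)) * Real.log (∫ x, f x ^ p)

/-- The generalized Fisher information of order `p`:
`I_p(f) = (∫ f^p)⁻¹ ∫_{f>0} |∇(f^p)|²/f`. -/
def fisherp (n : ℕ) (p : ℝ) (f : EuclideanSpace ℝ (Fin n) → ℝ) : ℝ :=
  (∫ x, f x ^ p)⁻¹ * ∫ x in {x | 0 < f x}, ‖gradient (fun y => f y ^ p) x‖ ^ 2 / f x

/-- The Laplacian of a function on `ℝⁿ`, as the sum of the second derivatives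
along the coordinate directions. -/
def lap (n : ℕ) (f : EuclideanSpace ℝ (Fin n) → ℝ) (x : EuclideanSpace ℝ (Fin n)) : ℝ :=
  ∑ i : Fin n, iteratedFDeriv ℝ 2 f x ![EuclideanSpace.single i 1, EuclideanSpace.single i 1]

/-- The partial derivative of `f` in the `i`-th coordinate direction. -/
def pd {n : ℕ} (i : Fin n) (f : EuclideanSpace ℝ (Fin n) → ℝ) (x : EuclideanSpace ℝ (Fin n)) : ℝ :=
  fderiv ℝ f x (EuclideanSpace.single i 1)

theorem deriv_deriv_nonneg_of_isLocalMin {f f' : ℝ → ℝ} {a c : ℝ}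
    (hf : ∀ᶠ x in 𝓝 a, HasDerivAt f (f' x) x) (hf' : HasDerivAt f' c a)
    (h : IsLocalMin f a) : 0 ≤ c := by
  by_contra! hc
  have e1 : deriv f =ᶠ[𝓝 a] f' := hf.mono fun x hx => hx.deriv
  have h0 : deriv f a = 0 := h.deriv_eq_zero
  have h2 : deriv (deriv f) a = c := by rw [e1.deriv_eq, hf'.deriv]
  have hmax : IsLocalMax f a :=
    isLocalMax_of_deriv_deriv_neg (by rw [h2]; exact hc) h0 hf.self_of_nhds.continuousAt
  have hconst : f =ᶠ[𝓝 a] fun _ => f a := by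
    filter_upwards [h, hmax] with x h1 h2 using le_antisymm h2 h1
  have hd : deriv (deriv f) a = 0 := by
    have : deriv f =ᶠ[𝓝 a] deriv fun _ => f a := hconst.deriv
    rw [this.deriv_eq]; simp
  linarith

section SecondDerivativeBounds

variable {g g' g'' : ℝ → ℝ} {N : ℝ} (h1 : ∀ x, HasDerivAt g (g' x) x)
  (h2 : ∀ x, HasDerivAt g' (g'' x) x)
include h1 h2

theorem convexOn_of_second_deriv_nonneg (h : ∀ x, 0 ≤ g'' x) : ConvexOn ℝ Set.univ g := by
  have e1 : deriv g = g' := funext fun x => (h1 x).deriv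
  have e2 : deriv g' = g'' := funext fun x => (h2 x).deriv
  refine convexOn_univ_of_deriv2_nonneg (fun x => (h1 x).differentiableAt) ?_ ?_
  · rw [e1]; exact fun x => (h2 x).differentiableAt
  · intro x; simp [e1, e2, h]

theorem two_mul_le_symm_add (h : ∀ x, 0 ≤ g'' x) (s : ℝ) : 2 * g 0 ≤ g s + g (-s) := by
  have := (convexOn_of_second_deriv_nonneg h1 h2 h).2 (Set.mem_univ s) (Set.mem_univ (-s))
    (show (0 : ℝ) ≤ 1 / 2 by norm_num) (show (0 : ℝ) ≤ 1 / 2 by norm_num) (by norm_num)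
  simp only [smul_eq_mul] at this
  rw [show 1 / 2 * s + 1 / 2 * -s = 0 by ring] at this
  linarith

theorem abs_symm_diff_le (h : ∀ x, |g'' x| ≤ N) (s : ℝ) : |g s + g (-s) - 2 * g 0| ≤ N * s ^ 2 := by
  have q1 : ∀ x : ℝ, HasDerivAt (fun x => N * x ^ 2 / 2) (N * x) x := fun x => by
    have := ((hasDerivAt_pow 2 x).const_mul N).div_const 2
    exact this.congr_deriv (by norm_num; try ring)
  have q2 : ∀ x : ℝ, HasDerivAt (fun x => N * x) N x := fun x => by
    simpa using (hasDerivAt_id x).const_mul N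
  have a := two_mul_le_symm_add (fun x => (q1 x).add (h1 x)) (fun x => (q2 x).add (h2 x))
    (fun x => by linarith [abs_le.1 (h x)]) s
  have b := two_mul_le_symm_add (fun x => (q1 x).sub (h1 x)) (fun x => (q2 x).sub (h2 x))
    (fun x => by linarith [abs_le.1 (h x)]) s
  simp only [Pi.add_apply, Pi.sub_apply] at a b
  rw [abs_le]; constructor <;> nlinarith

theorem abs_second_deriv_le_of_symm_diff (h : ∀ s, |g s + g (-s) - 2 * g 0| ≤ N * s ^ 2) :
    |g'' 0| ≤ N := by
  have q1 : ∀ x : ℝ, HasDerivAt (fun x => N * x ^ 2) (N * (2 * x)) x := fun x => by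
    have := ((hasDerivAt_pow 2 x).const_mul N)
    exact this.congr_deriv (by norm_num)
  have q2 : ∀ x : ℝ, HasDerivAt (fun x => N * (2 * x)) (2 * N) x := fun x => by
    have := (((hasDerivAt_id x).const_mul 2).const_mul N)
    exact this.congr_deriv (by norm_num; try ring)
  have r1 : ∀ x : ℝ, HasDerivAt (fun x => g x + g (-x)) (g' x - g' (-x)) x := fun x => by
    have := (h1 x).add ((h1 (-x)).scomp x (hasDerivAt_neg x))
    exact this.congr_deriv (by norm_num; try ring)
  have r2 : HasDerivAt (fun x => g' x - g' (-x)) (2 * g'' 0) 0 := by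
    have := (h2 0).sub (HasDerivAt.scomp (0 : ℝ) (g₁ := g') (g₁' := g'' 0)
      (by simpa using h2 0) (hasDerivAt_neg 0))
    exact this.congr_deriv (by norm_num; try ring)
  have a := deriv_deriv_nonneg_of_isLocalMin (a := 0)
    (Eventually.of_forall fun x => (q1 x).add (r1 x)) ((q2 0).add r2)
    (Eventually.of_forall fun s => by
      have := abs_le.1 (h s); simp only [Pi.add_apply]; norm_num; linarith)
  have b := deriv_deriv_nonneg_of_isLocalMin (a := 0)
    (Eventually.of_forall fun x => (q1 x).sub (r1 x)) ((q2 0).sub r2)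
    (Eventually.of_forall fun s => by
      have := abs_le.1 (h s); simp only [Pi.sub_apply]; norm_num; linarith)
  rw [abs_le]; constructor <;> linarith

theorem sq_deriv_le_of_nonneg (h : ∀ x, g'' x ≤ N) (hN : 0 < N) (hg : ∀ x, 0 ≤ g x) :
    g' 0 ^ 2 ≤ 2 * N * g 0 := by
  have key : ∀ s, 0 ≤ g 0 + g' 0 * s + N * s ^ 2 / 2 := by
    intro s
    have q1 : ∀ x : ℝ, HasDerivAt (fun x => N * x ^ 2 / 2 + g' 0 * x) (N * x + g' 0) x := fun x => by
      have := (((hasDerivAt_pow 2 x).const_mul N).div_const 2).add ((hasDerivAt_id x).const_mul (g' 0))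
      exact this.congr_deriv (by norm_num; try ring)
    have q2 : ∀ x : ℝ, HasDerivAt (fun x => N * x + g' 0) N x := fun x => by
      simpa using ((hasDerivAt_id x).const_mul N).add_const (g' 0)
    have cv := convexOn_of_second_deriv_nonneg (fun x => (q1 x).sub (h1 x))
      (fun x => (q2 x).sub (h2 x)) (fun x => by linarith [h x])
    have d0 : HasDerivAt ((fun x : ℝ => N * x ^ 2 / 2 + g' 0 * x) - g : ℝ → ℝ) 0 0 := by
      have := (q1 0).sub (h1 0)
      simpa using this
    have : ((fun x : ℝ => N * x ^ 2 / 2 + g' 0 * x) - g : ℝ → ℝ) 0 ≤ ((fun x : ℝ => N * x ^ 2 / 2 + g' 0 * x) - g : ℝ → ℝ) s := by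
      rcases lt_trichotomy s 0 with hs | hs | hs
      · have := cv.slope_le_of_hasDerivAt (Set.mem_univ s) (Set.mem_univ 0) hs d0
        rw [slope_def_field, div_le_iff₀ (by linarith)] at this
        linarith
      · rw [hs]
      · have := cv.le_slope_of_hasDerivAt (Set.mem_univ 0) (Set.mem_univ s) hs d0
        rw [slope_def_field, le_div_iff₀ (by linarith)] at this
        linarith
    simp only [Pi.sub_apply] at this
    have := hg s
    norm_num at *
    linarith
  have := key (-(g' 0) / N)
  have e : g 0 + g' 0 * (-(g' 0) / N) + N * (-(g' 0) / N) ^ 2 / 2 = g 0 - g' 0 ^ 2 / (2 * N) := by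
    field_simp; ring
  rw [e, sub_nonneg, div_le_iff₀ (by linarith)] at this
  linarith

end SecondDerivativeBounds

section PartialDerivatives

variable {n : ℕ} {f g : EuclideanSpace ℝ (Fin n) → ℝ}

theorem contDiff_pd (i : Fin n) (hf : ContDiff ℝ (⊤ : ℕ∞) f) : ContDiff ℝ (⊤ : ℕ∞) (pd i f) :=
  ((contDiff_infty_iff_fderiv.1 hf).2).clm_apply contDiff_const

theorem hasDerivAt_comp_line (i : Fin n) (hf : ContDiff ℝ (⊤ : ℕ∞) f) (x : EuclideanSpace ℝ (Fin n))
    (s : ℝ) : HasDerivAt (fun s : ℝ => f (x + s • EuclideanSpace.single i 1))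
      (pd i f (x + s • EuclideanSpace.single i 1)) s := by
  have h1 : HasDerivAt (fun s : ℝ => x + s • EuclideanSpace.single i (1 : ℝ))
      (EuclideanSpace.single i (1 : ℝ)) s := by
    simpa using ((hasDerivAt_id s).smul_const (EuclideanSpace.single i (1 : ℝ))).const_add x
  exact ((hf.differentiable (by simp)) _).hasFDerivAt.comp_hasDerivAt s h1

theorem iteratedFDeriv_two_single (hf : ContDiff ℝ (⊤ : ℕ∞) f) (i : Fin n)
    (x : EuclideanSpace ℝ (Fin n)) :
    iteratedFDeriv ℝ 2 f x ![EuclideanSpace.single i 1, EuclideanSpace.single i 1] =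
      pd i (pd i f) x := by
  rw [iteratedFDeriv_two_apply]
  simp only [Matrix.cons_val_zero, Matrix.cons_val_one]
  have hd : DifferentiableAt ℝ (fderiv ℝ f) x :=
    ((contDiff_infty_iff_fderiv.1 hf).2.differentiable (by simp)) x
  unfold pd
  rw [fderiv_clm_apply hd (differentiableAt_const _)]
  simp

theorem lap_eq_sum_pd (hf : ContDiff ℝ (⊤ : ℕ∞) f) (x : EuclideanSpace ℝ (Fin n)) :
    lap n f x = ∑ i, pd i (pd i f) x :=
  Finset.sum_congr rfl fun i _ => iteratedFDeriv_two_single hf i x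

theorem continuous_lap (hf : ContDiff ℝ (⊤ : ℕ∞) f) : Continuous (lap n f) := by
  rw [funext (lap_eq_sum_pd hf)]
  exact continuous_finsetSum _ fun i _ => (contDiff_pd i (contDiff_pd i hf)).continuous

theorem pd_sub (i : Fin n) (hf : ContDiff ℝ (⊤ : ℕ∞) f) (hg : ContDiff ℝ (⊤ : ℕ∞) g) :
    pd i (fun x => f x - g x) = fun x => pd i f x - pd i g x := by
  funext x
  unfold pd
  rw [fderiv_fun_sub ((hf.differentiable (by simp)) x) ((hg.differentiable (by simp)) x)]
  rfl

theorem contDiff_rpow_of_pos (hf : ContDiff ℝ (⊤ : ℕ∞) f) (h0 : ∀ x, 0 < f x) (q : ℝ) :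
    ContDiff ℝ (⊤ : ℕ∞) fun x => f x ^ q :=
  hf.rpow_const_of_ne fun x => (h0 x).ne'

theorem pd_rpow (i : Fin n) (hf : ContDiff ℝ (⊤ : ℕ∞) f) (h0 : ∀ x, 0 < f x) (q : ℝ)
    (x : EuclideanSpace ℝ (Fin n)) :
    pd i (fun x => f x ^ q) x = q * f x ^ (q - 1) * pd i f x := by
  unfold pd
  rw [((hf.differentiable (by simp) x).hasFDerivAt.rpow_const (Or.inl (h0 x).ne')).fderiv]
  simp

theorem pd_pd_rpow (i : Fin n) (hf : ContDiff ℝ (⊤ : ℕ∞) f) (h0 : ∀ x, 0 < f x) (q : ℝ)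
    (x : EuclideanSpace ℝ (Fin n)) :
    pd i (pd i (fun x => f x ^ q)) x =
      q * f x ^ (q - 1) * pd i (pd i f) x + q * (q - 1) * f x ^ (q - 2) * pd i f x ^ 2 := by
  have e : pd i (fun x => f x ^ q) = fun x => (q * f x ^ (q - 1)) * pd i f x :=
    funext (pd_rpow i hf h0 q)
  have e2 : pd i (fun x => f x ^ (q - 1)) x = (q - 1) * f x ^ (q - 1 - 1) * pd i f x :=
    pd_rpow i hf h0 (q - 1) x
  rw [e]
  have d1 : DifferentiableAt ℝ (fun x => f x ^ (q - 1)) x :=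
    (contDiff_rpow_of_pos hf h0 (q - 1)).differentiable (by simp) x
  have d2 : DifferentiableAt ℝ (pd i f) x := (contDiff_pd i hf).differentiable (by simp) x
  have : pd i (fun x => (q * f x ^ (q - 1)) * pd i f x) x =
      q * f x ^ (q - 1) * pd i (pd i f) x + pd i f x * (q * pd i (fun x => f x ^ (q - 1)) x) := by
    unfold pd at *
    rw [fderiv_fun_mul (d1.const_mul q) d2, fderiv_const_mul d1]
    simp
  rw [this, e2, show q - 1 - 1 = q - 2 by ring]
  ring

end PartialDerivatives

/-- A quantitative bound on the decay of `f` and on its pure second differences, which is stable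
under pointwise limits. -/
structure TameBound {n : ℕ} (N : ℝ) (k : ℕ) (f : EuclideanSpace ℝ (Fin n) → ℝ) : Prop where
  decay : ∀ x, (1 + ‖x‖) ^ k * f x ≤ N
  symm_diff : ∀ (x) (i : Fin n) (s : ℝ), |f (x + s • EuclideanSpace.single i 1) +
    f (x + (-s) • EuclideanSpace.single i 1) - 2 * f x| ≤ N * s ^ 2

namespace TameBound

variable {n k : ℕ} {N p : ℝ} {f g : EuclideanSpace ℝ (Fin n) → ℝ}

theorem mono {N' : ℝ} (h : TameBound N k f) (hN : N ≤ N') : TameBound N' k f where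
  decay x := (h.decay x).trans hN
  symm_diff x i s := (h.symm_diff x i s).trans (by gcongr)

theorem of_tendsto {ι : Type*} {l : Filter ι} [l.NeBot] {F : ι → EuclideanSpace ℝ (Fin n) → ℝ}
    (hF : ∀ᶠ j in l, TameBound N k (F j)) (hlim : ∀ x, Tendsto (fun j => F j x) l (𝓝 (f x))) :
    TameBound N k f where
  decay x := le_of_tendsto ((hlim x).const_mul _) (hF.mono fun _ h => h.decay x)
  symm_diff x i s := le_of_tendsto (((hlim _).add (hlim _)).sub ((hlim x).const_mul 2)).abs
    (hF.mono fun _ h => h.symm_diff x i s)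

theorem exists_of_decay (hf : ContDiff ℝ (⊤ : ℕ∞) f) (k : ℕ)
    (hdecay : ∀ k m : ℕ, ∃ C : ℝ, ∀ x, ‖x‖ ^ k * ‖iteratedFDeriv ℝ m f x‖ ≤ C) :
    ∃ N, TameBound N k f := by
  obtain ⟨C0, h0⟩ := hdecay 0 0
  obtain ⟨C1, h1⟩ := hdecay k 0
  obtain ⟨C2, h2⟩ := hdecay 0 2
  simp only [pow_zero, one_mul, norm_iteratedFDeriv_zero] at h0 h1 h2
  refine ⟨max (2 ^ (k - 1) * (C0 + C1)) C2, fun x => ?_, fun x i s => ?_⟩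
  · refine le_trans ?_ (le_max_left _ _)
    calc (1 + ‖x‖) ^ k * f x ≤ (1 + ‖x‖) ^ k * ‖f x‖ := by gcongr; exact le_abs_self _
      _ ≤ (2 ^ (k - 1) * (1 ^ k + ‖x‖ ^ k)) * ‖f x‖ := by
        gcongr; exact add_pow_le zero_le_one (norm_nonneg x) k
      _ = 2 ^ (k - 1) * (‖f x‖ + ‖x‖ ^ k * ‖f x‖) := by ring
      _ ≤ _ := by gcongr; exacts [h0 x, h1 x]
  · have hb : ∀ y, |pd i (pd i f) y| ≤ max (2 ^ (k - 1) * (C0 + C1)) C2 := fun y => by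
      rw [← iteratedFDeriv_two_single hf]
      refine (((iteratedFDeriv ℝ 2 f y).le_opNorm _).trans ?_).trans ((h2 y).trans (le_max_right _ _))
      simp [Fin.prod_univ_two]
    have := abs_symm_diff_le (hasDerivAt_comp_line i hf x) (hasDerivAt_comp_line i (contDiff_pd i hf) x)
      (fun s => hb _) s
    simpa using this

theorem abs_pd_pd_le (h : TameBound N k f) (hf : ContDiff ℝ (⊤ : ℕ∞) f) (i : Fin n)
    (x : EuclideanSpace ℝ (Fin n)) : |pd i (pd i f) x| ≤ N := by
  have := abs_second_deriv_le_of_symm_diff (hasDerivAt_comp_line i hf x)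
    (hasDerivAt_comp_line i (contDiff_pd i hf) x) (N := N) (fun s => by
      simpa using h.symm_diff x i s)
  simpa using this

theorem le (h : TameBound N k f) (h0 : ∀ x, 0 < f x) (x : EuclideanSpace ℝ (Fin n)) : f x ≤ N :=
  le_trans (le_mul_of_one_le_left (h0 x).le (one_le_pow₀ (by linarith [norm_nonneg x]))) (h.decay x)

theorem pos (h : TameBound N k f) (h0 : ∀ x, 0 < f x) : 0 < N :=
  (h0 0).trans_le (h.le h0 0)

theorem pd_sq_le (h : TameBound N k f) (hf : ContDiff ℝ (⊤ : ℕ∞) f) (h0 : ∀ x, 0 < f x) (i : Fin n)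
    (x : EuclideanSpace ℝ (Fin n)) : pd i f x ^ 2 ≤ 2 * N * f x := by
  have := sq_deriv_le_of_nonneg (hasDerivAt_comp_line i hf x)
    (hasDerivAt_comp_line i (contDiff_pd i hf) x)
    (fun s => (le_abs_self _).trans (h.abs_pd_pd_le hf i _)) (h.pos h0) (fun s => (h0 _).le)
  simpa using this

theorem abs_pd_le (h : TameBound N k f) (hf : ContDiff ℝ (⊤ : ℕ∞) f) (h0 : ∀ x, 0 < f x) (i : Fin n)
    (x : EuclideanSpace ℝ (Fin n)) : |pd i f x| ≤ 2 * N := by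
  refine abs_le_of_sq_le_sq ?_ (by linarith [h.pos h0])
  nlinarith [h.pd_sq_le hf h0 i x, h.le h0 x, h.pos h0]

theorem abs_pd_rpow_le (h : TameBound N k f) (hf : ContDiff ℝ (⊤ : ℕ∞) f) (h0 : ∀ x, 0 < f x)
    (hp : 1 < p) (i : Fin n) (x : EuclideanSpace ℝ (Fin n)) :
    |pd i (fun x => f x ^ p) x| ≤ p * (2 * N) * f x ^ (p - 1) := by
  have hr : 0 < f x ^ (p - 1) := rpow_pos_of_pos (h0 x) _
  rw [pd_rpow i hf h0, abs_mul, abs_of_pos (by positivity)]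
  nlinarith [mul_le_mul_of_nonneg_left (h.abs_pd_le hf h0 i x)
    (show 0 ≤ p * f x ^ (p - 1) by positivity)]

theorem abs_pd_pd_rpow_le (h : TameBound N k f) (hf : ContDiff ℝ (⊤ : ℕ∞) f) (h0 : ∀ x, 0 < f x)
    (hp : 1 < p) (i : Fin n) (x : EuclideanSpace ℝ (Fin n)) :
    |pd i (pd i (fun x => f x ^ p)) x| ≤ (p * N + p * (p - 1) * (2 * N)) * f x ^ (p - 1) := by
  have hr : 0 < f x ^ (p - 1) := rpow_pos_of_pos (h0 x) _
  have hr2 : 0 < f x ^ (p - 2) := rpow_pos_of_pos (h0 x) _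
  have e : f x ^ (p - 1) = f x ^ (p - 2) * f x := by
    rw [← rpow_add_one (h0 x).ne']; congr 1; ring
  have hp' : 0 < p - 1 := by linarith
  rw [pd_pd_rpow i hf h0]
  refine (abs_add_le _ _).trans ?_
  rw [add_mul]
  refine add_le_add ?_ ?_
  · rw [abs_mul, abs_of_pos (by positivity)]
    calc p * f x ^ (p - 1) * |pd i (pd i f) x| ≤ p * f x ^ (p - 1) * N := by
          gcongr; exact h.abs_pd_pd_le hf i x
      _ = _ := by ring
  · rw [abs_mul, abs_of_pos (by positivity), abs_of_nonneg (sq_nonneg _), e]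
    calc p * (p - 1) * f x ^ (p - 2) * pd i f x ^ 2
        ≤ p * (p - 1) * f x ^ (p - 2) * (2 * N * f x) := by
          gcongr; exact h.pd_sq_le hf h0 i x
      _ = _ := by ring

theorem abs_lap_rpow_le (h : TameBound N k f) (hf : ContDiff ℝ (⊤ : ℕ∞) f) (h0 : ∀ x, 0 < f x)
    (hp : 1 < p) (x : EuclideanSpace ℝ (Fin n)) :
    |lap n (fun x => f x ^ p) x| ≤ n * (p * N + p * (p - 1) * (2 * N)) * f x ^ (p - 1) := by
  rw [lap_eq_sum_pd (contDiff_rpow_of_pos hf h0 p)]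
  refine (Finset.abs_sum_le_sum_abs _ _).trans
    ((Finset.sum_le_sum fun i _ => h.abs_pd_pd_rpow_le hf h0 hp i x).trans ?_)
  simp [mul_assoc]

/-- The integrable weight dominating `f ^ (p - 1)` for a function `f` with a tame bound. -/
theorem rpow_le_weight (h : TameBound N k f) (h0 : ∀ x, 0 < f x) (hp : 1 < p)
    (x : EuclideanSpace ℝ (Fin n)) :
    f x ^ (p - 1) ≤ N ^ (p - 1) * (1 + ‖x‖) ^ (-(k * (p - 1))) := by
  have h1 : 0 < 1 + ‖x‖ := by linarith [norm_nonneg x]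
  have hN := h.pos h0
  have : f x ≤ N * (1 + ‖x‖) ^ (-(k : ℝ)) := by
    rw [rpow_neg h1.le, rpow_natCast, ← div_eq_mul_inv, le_div_iff₀ (by positivity), mul_comm]
    exact h.decay x
  calc f x ^ (p - 1) ≤ (N * (1 + ‖x‖) ^ (-(k : ℝ))) ^ (p - 1) :=
        rpow_le_rpow (h0 x).le this (by linarith)
    _ = _ := by
      rw [mul_rpow hN.le (by positivity), ← rpow_mul h1.le]; congr 2; ring

theorem integrable_weight (hk : (n : ℝ) < k * (p - 1)) :
    Integrable fun x : EuclideanSpace ℝ (Fin n) => (1 + ‖x‖) ^ (-(k * (p - 1))) :=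
  integrable_one_add_norm (by simpa using hk)

theorem integrable_rpow_sub_one (h : TameBound N k f) (hf : ContDiff ℝ (⊤ : ℕ∞) f)
    (h0 : ∀ x, 0 < f x) (hp : 1 < p) (hk : (n : ℝ) < k * (p - 1)) :
    Integrable fun x => f x ^ (p - 1) :=
  ((integrable_weight hk).const_mul (N ^ (p - 1))).mono'
    (contDiff_rpow_of_pos hf h0 _).continuous.aestronglyMeasurable
    (Eventually.of_forall fun x => by
      rw [norm_of_nonneg (rpow_nonneg (h0 x).le _)]; exact h.rpow_le_weight h0 hp x)

/-- Every continuous function bounded by a multiple of `f ^ (p - 1)` is integrable. -/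
theorem integrable_of_abs_le (h : TameBound N k f) (hf : ContDiff ℝ (⊤ : ℕ∞) f)
    (h0 : ∀ x, 0 < f x) (hp : 1 < p) (hk : (n : ℝ) < k * (p - 1)) {u : EuclideanSpace ℝ (Fin n) → ℝ}
    (hu : Continuous u) {C : ℝ} (hC : ∀ x, |u x| ≤ C * f x ^ (p - 1)) : Integrable u :=
  ((h.integrable_rpow_sub_one hf h0 hp hk).const_mul C).mono' hu.aestronglyMeasurable
    (Eventually.of_forall hC)

theorem integrable_lap_rpow (h : TameBound N k f) (hf : ContDiff ℝ (⊤ : ℕ∞) f)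
    (h0 : ∀ x, 0 < f x) (hp : 1 < p) (hk : (n : ℝ) < k * (p - 1)) :
    Integrable (lap n fun x => f x ^ p) :=
  h.integrable_of_abs_le hf h0 hp hk (continuous_lap (contDiff_rpow_of_pos hf h0 p))
    (h.abs_lap_rpow_le hf h0 hp)

theorem integral_abs_lap_rpow_le (h : TameBound N k f) (hf : ContDiff ℝ (⊤ : ℕ∞) f)
    (h0 : ∀ x, 0 < f x) (hp : 1 < p) (hk : (n : ℝ) < k * (p - 1)) :
    ∫ x, |lap n (fun x => f x ^ p) x| ≤ n * (p * N + p * (p - 1) * (2 * N)) * (N ^ (p - 1) *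
      ∫ x : EuclideanSpace ℝ (Fin n), (1 + ‖x‖) ^ (-(k * (p - 1)))) := by
  have hN := h.pos h0
  have hp' : 0 < p - 1 := by linarith
  rw [← integral_const_mul, ← integral_const_mul]
  refine integral_mono (h.integrable_lap_rpow hf h0 hp hk).abs
    (((integrable_weight hk).const_mul _).const_mul _) fun x => ?_
  exact (h.abs_lap_rpow_le hf h0 hp x).trans
    (mul_le_mul_of_nonneg_left (h.rpow_le_weight h0 hp x) (by positivity))

end TameBound

section Kato

theorem hasDerivAt_max_zero_sq (s : ℝ) :
    HasDerivAt (fun s : ℝ => max s 0 ^ 2) (2 * max s 0) s := by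
  rcases lt_trichotomy s 0 with hs | hs | hs
  · have : (fun s : ℝ => max s 0 ^ 2) =ᶠ[𝓝 s] fun _ => 0 := by
      filter_upwards [gt_mem_nhds hs] with r hr
      simp [max_eq_right hr.le]
    rw [max_eq_right hs.le, mul_zero]
    exact (hasDerivAt_const s (0 : ℝ)).congr_of_eventuallyEq this
  · subst hs
    rw [hasDerivAt_iff_isLittleO]
    simp only [max_self, mul_zero, smul_zero, sub_zero, ne_eq, OfNat.ofNat_ne_zero,
      not_false_eq_true, zero_pow]
    refine Asymptotics.IsLittleO.of_norm_left (Asymptotics.IsBigO.trans_isLittleO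
      (g := fun x : ℝ => x ^ 2) (Asymptotics.IsBigO.of_bound 1 (Eventually.of_forall fun x => ?_)) ?_)
    · rcases le_total x 0 with hx | hx
      · simp [max_eq_right hx, sq_nonneg]
      · simp [max_eq_left hx]
    · simpa using (Asymptotics.isLittleO_pow_id (𝕜 := ℝ) one_lt_two)
  · have : (fun s : ℝ => max s 0 ^ 2) =ᶠ[𝓝 s] fun s => s ^ 2 := by
      filter_upwards [lt_mem_nhds hs] with r hr
      simp [max_eq_left (le_of_lt hr)]
    rw [max_eq_left hs.le]
    exact ((hasDerivAt_pow 2 s).congr_of_eventuallyEq this).congr_deriv (by norm_num)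

/-- A differentiable nondecreasing approximation of the indicator function of `(0, ∞)`. -/
def smoothStep (m : ℕ) (s : ℝ) : ℝ := m * max s 0 ^ 2 / (1 + m * max s 0 ^ 2)

theorem smoothStep_nonneg (m : ℕ) (s : ℝ) : 0 ≤ smoothStep m s := by
  unfold smoothStep; positivity

theorem smoothStep_le_one (m : ℕ) (s : ℝ) : smoothStep m s ≤ 1 := by
  unfold smoothStep
  rw [div_le_one (by positivity)]
  linarith

theorem abs_smoothStep_le_one (m : ℕ) (s : ℝ) : |smoothStep m s| ≤ 1 := by
  rw [abs_of_nonneg (smoothStep_nonneg m s)]; exact smoothStep_le_one m s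

theorem hasDerivAt_smoothStep (m : ℕ) (s : ℝ) :
    HasDerivAt (smoothStep m) (2 * m * max s 0 / (1 + m * max s 0 ^ 2) ^ 2) s := by
  have h := (hasDerivAt_max_zero_sq s).const_mul (m : ℝ)
  have hne : (1 + m * max s 0 ^ 2 : ℝ) ≠ 0 := by positivity
  refine (h.div (h.const_add 1) hne).congr_deriv ?_
  field_simp
  ring

theorem continuous_smoothStep (m : ℕ) : Continuous (smoothStep m) :=
  continuous_iff_continuousAt.2 fun s => (hasDerivAt_smoothStep m s).continuousAt

theorem tendsto_smoothStep (s : ℝ) :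
    Tendsto (fun m => smoothStep m s) atTop (𝓝 (if 0 < s then 1 else 0)) := by
  split_ifs with hs
  · have h0 : 0 < max s 0 ^ 2 := by rw [max_eq_left hs.le]; positivity
    have h1 : Tendsto (fun m : ℕ => 1 + (m : ℝ) * max s 0 ^ 2) atTop atTop :=
      tendsto_atTop_add_const_left _ _ (tendsto_natCast_atTop_atTop.atTop_mul_const h0)
    have h2 := (tendsto_const_nhds (x := (1 : ℝ))).sub h1.inv_tendsto_atTop
    rw [sub_zero] at h2
    refine h2.congr fun m => ?_
    have : (1 + m * max s 0 ^ 2 : ℝ) ≠ 0 := by positivity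
    simp only [Pi.inv_apply, smoothStep]
    field_simp
    ring
  · have : ∀ m, smoothStep m s = 0 := fun m => by
      simp [smoothStep, max_eq_right (not_lt.1 hs)]
    simp [this]

variable {n : ℕ} {h : EuclideanSpace ℝ (Fin n) → ℝ} {B : ℝ}

theorem integral_smoothStep_mul_pd_pd_nonpos (hh : ContDiff ℝ (⊤ : ℕ∞) h) (i : Fin n)
    (hB : ∀ x, |pd i h x| ≤ B) (h1 : Integrable (pd i h)) (h2 : Integrable (pd i (pd i h)))
    (m : ℕ) : ∫ x, smoothStep m (h x) * pd i (pd i h) x ≤ 0 := by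
  have hc1 := (contDiff_pd i hh).continuous
  have hd : ∀ x, HasFDerivAt (fun x => smoothStep m (h x))
      ((2 * m * max (h x) 0 / (1 + m * max (h x) 0 ^ 2) ^ 2) • fderiv ℝ h x) x := fun x =>
    (hasDerivAt_smoothStep m (h x)).comp_hasFDerivAt x
      (hh.differentiable (by simp) x).hasFDerivAt
  have hpd : ∀ x, fderiv ℝ (fun x => smoothStep m (h x)) x (EuclideanSpace.single i 1) =
      2 * m * max (h x) 0 / (1 + m * max (h x) 0 ^ 2) ^ 2 * pd i h x := fun x => by
    rw [(hd x).fderiv]; rfl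
  have hbd : ∀ x, ‖2 * m * max (h x) 0 / (1 + m * max (h x) 0 ^ 2) ^ 2 * pd i h x‖ ≤
      (m + 1) * B := fun x => by
    rw [norm_mul]
    refine mul_le_mul ?_ (hB x) (norm_nonneg _) (by positivity)
    rw [norm_of_nonneg (by positivity), div_le_iff₀ (by positivity)]
    set r := max (h x) 0
    have hm : (0 : ℝ) ≤ m := m.cast_nonneg
    nlinarith [mul_nonneg hm (sq_nonneg (r - 1)), mul_nonneg hm (sq_nonneg r),
      mul_nonneg (mul_nonneg hm hm) (sq_nonneg r), sq_nonneg ((m : ℝ) * r ^ 2),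
      mul_nonneg hm (sq_nonneg ((m : ℝ) * r ^ 2))]
  have cη : Continuous fun x => smoothStep m (h x) := (continuous_smoothStep m).comp hh.continuous
  have key := integral_mul_fderiv_eq_neg_fderiv_mul_of_integrable (μ := volume)
    (f := fun x => smoothStep m (h x)) (g := pd i h) (v := EuclideanSpace.single i 1) ?_ ?_ ?_
    (fun x _ => (hd x).differentiableAt)
    (fun x _ => (contDiff_pd i hh).differentiable (by simp) x)
  · refine key.trans_le (neg_nonpos.2 (integral_nonneg fun x => ?_))
    show 0 ≤ fderiv ℝ (fun x => smoothStep m (h x)) x (EuclideanSpace.single i 1) * pd i h x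
    rw [hpd, mul_assoc]
    exact mul_nonneg (by positivity) (mul_self_nonneg _)
  · simp_rw [hpd]
    refine h1.bdd_mul (c := (m + 1) * B) ?_ (Eventually.of_forall hbd)
    refine Continuous.aestronglyMeasurable ?_
    have := hh.continuous
    refine Continuous.mul (Continuous.div (by fun_prop) (by fun_prop) fun x => by positivity) hc1
  · exact h2.bdd_mul (c := 1) cη.aestronglyMeasurable
      (Eventually.of_forall fun x => abs_smoothStep_le_one _ _)
  · exact h1.bdd_mul (c := 1) cη.aestronglyMeasurable
      (Eventually.of_forall fun x => abs_smoothStep_le_one _ _)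

/-- **Kato's inequality**, integrated form. -/
theorem setIntegral_lap_nonpos (hh : ContDiff ℝ (⊤ : ℕ∞) h)
    (hB : ∀ i x, |pd i h x| ≤ B) (h1 : ∀ i, Integrable (pd i h))
    (h2 : ∀ i, Integrable (pd i (pd i h))) :
    ∫ x in {x | 0 < h x}, lap n h x ≤ 0 := by
  have hm : MeasurableSet {x | 0 < h x} := (isOpen_lt continuous_const hh.continuous).measurableSet
  have hl : Integrable (lap n h) := by
    rw [funext (lap_eq_sum_pd hh)]
    exact integrable_finsetSum _ fun i _ => h2 i
  have lim : Tendsto (fun m : ℕ => ∫ x, smoothStep m (h x) * lap n h x) atTop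
      (𝓝 (∫ x, (if 0 < h x then 1 else 0) * lap n h x)) := by
    refine tendsto_integral_of_dominated_convergence (fun x => |lap n h x|) (fun m => ?_) hl.abs
      (fun m => Eventually.of_forall fun x => ?_)
      (Eventually.of_forall fun x => (tendsto_smoothStep (h x)).mul_const _)
    · exact (((continuous_smoothStep m).comp hh.continuous).mul
        (continuous_lap hh)).aestronglyMeasurable
    · rw [norm_mul]
      exact mul_le_of_le_one_left (norm_nonneg _) (abs_smoothStep_le_one _ _)
  have e : ∫ x in {x | 0 < h x}, lap n h x = ∫ x, (if 0 < h x then 1 else 0) * lap n h x := by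
    rw [← integral_indicator hm]
    refine integral_congr_ae (Eventually.of_forall fun x => ?_)
    by_cases hx : 0 < h x <;> simp [Set.indicator, hx]
  rw [e]
  refine le_of_tendsto lim (Eventually.of_forall fun m => ?_)
  simp_rw [lap_eq_sum_pd hh, Finset.mul_sum]
  rw [integral_finsetSum]
  · exact Finset.sum_nonpos fun i _ =>
      integral_smoothStep_mul_pd_pd_nonpos hh i (hB i) (h1 i) (h2 i) m
  · exact fun i _ => (h2 i).bdd_mul (c := 1)
      ((continuous_smoothStep m).comp hh.continuous).aestronglyMeasurable
      (Eventually.of_forall fun x => abs_smoothStep_le_one _ _)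

end Kato

theorem lap_sub {n : ℕ} {f g : EuclideanSpace ℝ (Fin n) → ℝ} (hf : ContDiff ℝ (⊤ : ℕ∞) f)
    (hg : ContDiff ℝ (⊤ : ℕ∞) g) (x : EuclideanSpace ℝ (Fin n)) :
    lap n (fun x => f x - g x) x = lap n f x - lap n g x := by
  rw [lap_eq_sum_pd (hf.sub hg), lap_eq_sum_pd hf, lap_eq_sum_pd hg, ← Finset.sum_sub_distrib]
  refine Finset.sum_congr rfl fun i _ => ?_
  rw [pd_sub i hf hg, pd_sub i (contDiff_pd i hf) (contDiff_pd i hg)]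

theorem norm_gradient_sq_eq_sum_pd {n : ℕ} (f : EuclideanSpace ℝ (Fin n) → ℝ)
    (x : EuclideanSpace ℝ (Fin n)) : ‖gradient f x‖ ^ 2 = ∑ i, pd i f x ^ 2 := by
  rw [EuclideanSpace.norm_sq_eq]
  refine Finset.sum_congr rfl fun i _ => ?_
  have : (gradient f x) i = pd i f x := by
    have := EuclideanSpace.inner_single_right (𝕜 := ℝ) i 1 (gradient f x)
    rw [inner_gradient_left] at this
    simpa [pd] using this.symm
  rw [this, norm_eq_abs, sq_abs]

namespace TameBound

variable {n k : ℕ} {N p : ℝ} {f g : EuclideanSpace ℝ (Fin n) → ℝ}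

theorem integrable_pd_rpow (h : TameBound N k f) (hf : ContDiff ℝ (⊤ : ℕ∞) f)
    (h0 : ∀ x, 0 < f x) (hp : 1 < p) (hk : (n : ℝ) < k * (p - 1)) (i : Fin n) :
    Integrable (pd i fun x => f x ^ p) :=
  h.integrable_of_abs_le hf h0 hp hk (contDiff_pd i (contDiff_rpow_of_pos hf h0 p)).continuous
    (h.abs_pd_rpow_le hf h0 hp i)

theorem integrable_pd_pd_rpow (h : TameBound N k f) (hf : ContDiff ℝ (⊤ : ℕ∞) f)
    (h0 : ∀ x, 0 < f x) (hp : 1 < p) (hk : (n : ℝ) < k * (p - 1)) (i : Fin n) :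
    Integrable (pd i (pd i fun x => f x ^ p)) :=
  h.integrable_of_abs_le hf h0 hp hk
    (contDiff_pd i (contDiff_pd i (contDiff_rpow_of_pos hf h0 p))).continuous
    (h.abs_pd_pd_rpow_le hf h0 hp i)

theorem abs_pd_rpow_le_const (h : TameBound N k f) (hf : ContDiff ℝ (⊤ : ℕ∞) f)
    (h0 : ∀ x, 0 < f x) (hp : 1 < p) (i : Fin n) (x : EuclideanSpace ℝ (Fin n)) :
    |pd i (fun x => f x ^ p) x| ≤ p * (2 * N) * N ^ (p - 1) := by
  have := h.pos h0
  exact (h.abs_pd_rpow_le hf h0 hp i x).trans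
    (mul_le_mul_of_nonneg_left (rpow_le_rpow (h0 x).le (h.le h0 x) (by linarith)) (by positivity))

theorem setIntegral_lap_rpow_sub_nonpos {N' : ℝ} (h : TameBound N k f) (h' : TameBound N' k g)
    (hf : ContDiff ℝ (⊤ : ℕ∞) f) (hg : ContDiff ℝ (⊤ : ℕ∞) g) (h0 : ∀ x, 0 < f x)
    (h0' : ∀ x, 0 < g x) (hp : 1 < p) (hk : (n : ℝ) < k * (p - 1)) :
    ∫ x in {x | 0 < f x - g x}, (lap n (fun x => f x ^ p) x - lap n (fun x => g x ^ p) x) ≤ 0 := by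
  have hF := contDiff_rpow_of_pos hf h0 p
  have hG := contDiff_rpow_of_pos hg h0' p
  have e : {x | 0 < f x - g x} = {x | 0 < f x ^ p - g x ^ p} := by
    ext x
    simp only [Set.mem_ofPred_eq, sub_pos]
    exact (rpow_lt_rpow_iff (h0' x).le (h0 x).le (by linarith)).symm
  rw [e]
  have := setIntegral_lap_nonpos (hF.sub hG)
    (B := p * (2 * N) * N ^ (p - 1) + p * (2 * N') * N' ^ (p - 1))
    (fun i x => by
      rw [pd_sub i hF hG]
      exact (abs_sub _ _).trans (add_le_add (h.abs_pd_rpow_le_const hf h0 hp i x)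
        (h'.abs_pd_rpow_le_const hg h0' hp i x)))
    (fun i => by
      rw [pd_sub i hF hG]
      exact (h.integrable_pd_rpow hf h0 hp hk i).sub (h'.integrable_pd_rpow hg h0' hp hk i))
    (fun i => by
      rw [pd_sub i hF hG, pd_sub i (contDiff_pd i hF) (contDiff_pd i hG)]
      exact (h.integrable_pd_pd_rpow hf h0 hp hk i).sub (h'.integrable_pd_pd_rpow hg h0' hp hk i))
  simpa only [lap_sub hF hG] using this

theorem integral_lap_rpow (h : TameBound N k f) (hf : ContDiff ℝ (⊤ : ℕ∞) f)
    (h0 : ∀ x, 0 < f x) (hp : 1 < p) (hk : (n : ℝ) < k * (p - 1)) :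
    ∫ x, lap n (fun x => f x ^ p) x = 0 := by
  have hF := contDiff_rpow_of_pos hf h0 p
  simp_rw [lap_eq_sum_pd hF]
  rw [integral_finsetSum _ fun i _ => h.integrable_pd_pd_rpow hf h0 hp hk i]
  refine Finset.sum_eq_zero fun i _ => ?_
  have := integral_mul_fderiv_eq_neg_fderiv_mul_of_integrable (μ := volume)
    (f := fun _ => (1 : ℝ)) (g := pd i fun x => f x ^ p) (v := EuclideanSpace.single i 1)
    (by simp) ((h.integrable_pd_pd_rpow hf h0 hp hk i).const_mul 1)
    (by simpa using h.integrable_pd_rpow hf h0 hp hk i) (fun x _ => differentiableAt_const _)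
    (fun x _ => (contDiff_pd i hF).differentiable (by simp) x)
  simp only [one_mul, fderiv_fun_const, Pi.zero_apply, _root_.zero_apply, zero_mul,
    integral_zero, neg_zero] at this
  exact this

theorem integral_mul_pd_pd_rpow (h : TameBound N k f) (hf : ContDiff ℝ (⊤ : ℕ∞) f)
    (h0 : ∀ x, 0 < f x) (hp : 1 < p) (hk : (n : ℝ) < k * (p - 1)) (i : Fin n) :
    Integrable (fun x => pd i (fun x => f x ^ p) x ^ 2 / f x) ∧
    Integrable (fun x => p * f x ^ (p - 1) * pd i (pd i fun x => f x ^ p) x) ∧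
    ∫ x, p * f x ^ (p - 1) * pd i (pd i fun x => f x ^ p) x =
      -((p - 1) * ∫ x, pd i (fun x => f x ^ p) x ^ 2 / f x) := by
  have hF := contDiff_rpow_of_pos hf h0 p
  have hG := contDiff_rpow_of_pos hf h0 (p - 1)
  have hN := h.pos h0
  have hp' : 0 < p - 1 := by linarith
  have c1 : Integrable (fun x => pd i (fun x => f x ^ p) x ^ 2 / f x) := by
    refine h.integrable_of_abs_le hf h0 hp hk (C := p ^ 2 * (2 * N) * N ^ (p - 1))
      (((contDiff_pd i hF).continuous.pow 2).div hf.continuous fun x => (h0 x).ne') fun x => ?_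
    have hr : 0 < f x ^ (p - 1) := rpow_pos_of_pos (h0 x) _
    rw [abs_of_nonneg (div_nonneg (sq_nonneg _) (h0 x).le), div_le_iff₀ (h0 x), pd_rpow i hf h0]
    calc (p * f x ^ (p - 1) * pd i f x) ^ 2 = p ^ 2 * f x ^ (p - 1) * f x ^ (p - 1) * pd i f x ^ 2 := by
          ring
      _ ≤ p ^ 2 * f x ^ (p - 1) * N ^ (p - 1) * (2 * N * f x) := by
          gcongr
          · exact (h0 x).le
          · exact h.le h0 x
          · exact h.pd_sq_le hf h0 i x
      _ = _ := by ring
  have hbd : ∀ x, ‖p * f x ^ (p - 1)‖ ≤ p * N ^ (p - 1) := fun x => by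
    have hr : 0 < f x ^ (p - 1) := rpow_pos_of_pos (h0 x) _
    rw [norm_of_nonneg (by positivity)]
    gcongr
    · exact (h0 x).le
    · exact h.le h0 x
  have hcont : Continuous fun x => p * f x ^ (p - 1) := continuous_const.mul hG.continuous
  have c2 : Integrable (fun x => p * f x ^ (p - 1) * pd i (pd i fun x => f x ^ p) x) :=
    (h.integrable_pd_pd_rpow hf h0 hp hk i).bdd_mul hcont.aestronglyMeasurable
      (Eventually.of_forall hbd)
  have e : ∀ x, fderiv ℝ (fun x => p * f x ^ (p - 1)) x (EuclideanSpace.single i 1) *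
      pd i (fun x => f x ^ p) x = (p - 1) * (pd i (fun x => f x ^ p) x ^ 2 / f x) := fun x => by
    have h3 := pd_rpow i hf h0 (p - 1) x
    have h4 : f x ^ (p - 1 - 1) = f x ^ (p - 1) / f x := by rw [rpow_sub_one (h0 x).ne']
    rw [fderiv_const_mul (hG.differentiable (by simp) x)]
    change (p * pd i (fun x => f x ^ (p - 1)) x) * _ = _
    rw [h3, h4, pd_rpow i hf h0]
    have := (h0 x).ne'
    field_simp
  refine ⟨c1, c2, ?_⟩
  have := integral_mul_fderiv_eq_neg_fderiv_mul_of_integrable (μ := volume)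
    (f := fun x => p * f x ^ (p - 1)) (g := pd i fun x => f x ^ p) (v := EuclideanSpace.single i 1)
    (by simp_rw [e]; exact c1.const_mul _) c2
    ((h.integrable_pd_rpow hf h0 hp hk i).bdd_mul hcont.aestronglyMeasurable
      (Eventually.of_forall hbd)) (fun x _ => (hG.differentiable (by simp) x).const_mul p)
    (fun x _ => (contDiff_pd i hF).differentiable (by simp) x)
  simp_rw [e] at this
  rw [integral_const_mul] at this
  exact this

theorem integral_mul_lap_rpow (h : TameBound N k f) (hf : ContDiff ℝ (⊤ : ℕ∞) f)
    (h0 : ∀ x, 0 < f x) (hp : 1 < p) (hk : (n : ℝ) < k * (p - 1)) :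
    ∫ x, p * f x ^ (p - 1) * lap n (fun x => f x ^ p) x =
      -((p - 1) * ∫ x, ‖gradient (fun y => f y ^ p) x‖ ^ 2 / f x) := by
  have key := h.integral_mul_pd_pd_rpow hf h0 hp hk
  simp_rw [lap_eq_sum_pd (contDiff_rpow_of_pos hf h0 p), norm_gradient_sq_eq_sum_pd,
    Finset.sum_div, Finset.mul_sum]
  rw [integral_finsetSum _ fun i _ => (key i).2.1, integral_finsetSum _ fun i _ => (key i).1,
    Finset.mul_sum, ← Finset.sum_neg_distrib]
  exact Finset.sum_congr rfl fun i _ => (key i).2.2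

end TameBound

section IntegralLemmas

/-- **Scheffé's lemma** along a countably generated filter. -/
theorem tendsto_integral_abs_sub_of_tendsto_integral {α ι : Type*} [MeasurableSpace α]
    {μ : Measure α} {l : Filter ι} [l.IsCountablyGenerated] {F : ι → α → ℝ} {f : α → ℝ}
    (hF : ∀ᶠ j in l, Integrable (F j) μ) (hf : Integrable f μ)
    (hpos : ∀ᶠ j in l, ∀ x, 0 ≤ F j x)
    (hlim : ∀ x, Tendsto (fun j => F j x) l (𝓝 (f x)))
    (hint : Tendsto (fun j => ∫ x, F j x ∂μ) l (𝓝 (∫ x, f x ∂μ))) :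
    Tendsto (fun j => ∫ x, |F j x - f x| ∂μ) l (𝓝 0) := by
  have h1 : Tendsto (fun j => ∫ x, max (f x - F j x) 0 ∂μ) l (𝓝 (∫ _, (0 : ℝ) ∂μ)) := by
    refine tendsto_integral_filter_of_dominated_convergence (fun x => |f x|) ?_ ?_ hf.abs
      (Eventually.of_forall fun x => ?_)
    · filter_upwards [hF] with j hj using (hf.sub hj).pos_part.aestronglyMeasurable
    · filter_upwards [hpos] with j hj
      refine Eventually.of_forall fun x => ?_
      rw [norm_of_nonneg (le_max_right _ _)]
      exact max_le (by linarith [hj x, le_abs_self (f x)]) (abs_nonneg _)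
    · have := ((tendsto_const_nhds (x := f x)).sub (hlim x)).max (tendsto_const_nhds (x := (0 : ℝ)))
      simpa using this
  have h2 := (hint.sub_const (∫ x, f x ∂μ)).add (h1.const_mul 2)
  simp only [sub_self, integral_zero, mul_zero, add_zero] at h2
  refine h2.congr' ?_
  filter_upwards [hF] with j hj
  rw [← integral_sub hj hf, ← integral_const_mul, ← integral_add
    (f := fun x => F j x - f x) (g := fun x => 2 * max (f x - F j x) 0) (hj.sub hf)
    ((hf.sub hj).pos_part.const_mul 2)]
  refine integral_congr_ae (Eventually.of_forall fun x => ?_)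
  beta_reduce
  rcases le_total (F j x) (f x) with h | h
  · rw [abs_of_nonpos (by linarith), max_eq_left (by linarith)]; ring
  · rw [abs_of_nonneg (by linarith), max_eq_right (by linarith)]; ring

/-- The fundamental theorem of calculus for the positive part of a function. -/
theorem max_zero_sub_max_zero_eq_integral {g g' : ℝ → ℝ} {s t : ℝ} (hst : s ≤ t)
    (hg : ∀ r ∈ Set.Icc s t, HasDerivAt g (g' r) r) (hint : IntervalIntegrable g' volume s t) :
    max (g t) 0 - max (g s) 0 = ∫ r in s..t, if 0 < g r then g' r else 0 := by
  set ε : ℕ → ℝ := fun m => 1 / ((m : ℝ) + 1) with hε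
  have hε0 : ∀ m, 0 < ε m := fun m => by positivity
  have hεlim : Tendsto ε atTop (𝓝 0) := tendsto_one_div_add_atTop_nhds_zero_nat
  have hder : ∀ (m : ℕ) (u : ℝ), HasDerivAt (fun u => √(ε m + max u 0 ^ 2))
      (max u 0 / √(ε m + max u 0 ^ 2)) u := fun m u => by
    have hpos : 0 < ε m + max u 0 ^ 2 := by have := hε0 m; positivity
    refine (((hasDerivAt_max_zero_sq u).const_add (ε m)).sqrt hpos.ne').congr_deriv ?_
    have := (sqrt_pos.2 hpos).ne'
    field_simp
  have hcont : ContinuousOn g (Set.Icc s t) := fun r hr => (hg r hr).continuousAt.continuousWithinAt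
  have hdc : ∀ m : ℕ, Continuous fun u : ℝ => max u 0 / √(ε m + max u 0 ^ 2) := fun m => by
    refine Continuous.div (by fun_prop) (by fun_prop) fun u => ?_
    have := hε0 m
    positivity
  have hle : ∀ (m : ℕ) (u : ℝ), ‖max u 0 / √(ε m + max u 0 ^ 2)‖ ≤ 1 := fun m u => by
    have := hε0 m
    rw [norm_of_nonneg (by positivity), div_le_one (by positivity)]
    exact le_sqrt_of_sq_le (by linarith)
  have hsm : ∀ m : ℕ, AEStronglyMeasurable (fun r => max (g r) 0 / √(ε m + max (g r) 0 ^ 2))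
      (volume.restrict (Set.uIoc s t)) := fun m => by
    rw [Set.uIoc_of_le hst]
    exact (((hdc m).comp_continuousOn hcont).mono Set.Ioc_subset_Icc_self).aestronglyMeasurable
      measurableSet_Ioc
  have hii : ∀ m : ℕ, IntervalIntegrable
      (fun r => max (g r) 0 / √(ε m + max (g r) 0 ^ 2) * g' r) volume s t := fun m => by
    rw [intervalIntegrable_iff] at hint ⊢
    exact hint.bdd_mul (c := 1) (hsm m) (Eventually.of_forall fun r => hle m _)
  have hftc : ∀ m : ℕ, ∫ r in s..t, max (g r) 0 / √(ε m + max (g r) 0 ^ 2) * g' r =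
      √(ε m + max (g t) 0 ^ 2) - √(ε m + max (g s) 0 ^ 2) := fun m =>
    intervalIntegral.integral_eq_sub_of_hasDerivAt (f := fun r => √(ε m + max (g r) 0 ^ 2))
      (fun r hr => (hder m (g r)).comp r (hg r (Set.uIcc_of_le hst ▸ hr))) (hii m)
  have l1 : ∀ u : ℝ, Tendsto (fun m => √(ε m + max u 0 ^ 2)) atTop (𝓝 (max u 0)) := fun u => by
    have := (hεlim.add_const (max u 0 ^ 2)).sqrt
    rwa [zero_add, sqrt_sq (le_max_right _ _)] at this
  have l2 : Tendsto (fun m => ∫ r in s..t, max (g r) 0 / √(ε m + max (g r) 0 ^ 2) * g' r) atTop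
      (𝓝 (∫ r in s..t, if 0 < g r then g' r else 0)) := by
    refine intervalIntegral.tendsto_integral_filter_of_dominated_convergence (fun r => ‖g' r‖)
      (Eventually.of_forall fun m => ((intervalIntegrable_iff.1 (hii m))).aestronglyMeasurable)
      (Eventually.of_forall fun m => Eventually.of_forall fun r _ => ?_) hint.norm
      (Eventually.of_forall fun r _ => ?_)
    · rw [norm_mul]; exact mul_le_of_le_one_left (norm_nonneg _) (hle m _)
    · split_ifs with h
      · have := ((tendsto_const_nhds (x := max (g r) 0)).div (l1 (g r))
          (by rw [max_eq_left h.le]; exact h.ne')).mul_const (g' r)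
        rwa [div_self (by rw [max_eq_left h.le]; exact h.ne'), one_mul] at this
      · simp [max_eq_right (not_lt.1 h)]
  refine tendsto_nhds_unique ((l1 (g t)).sub (l1 (g s))) (l2.congr hftc)

/-- A differential inequality for the integral of the positive part of a function depending on
time. -/
theorem integral_max_zero_le {α : Type*} [MeasurableSpace α] {μ : Measure α} [SFinite μ]
    {d δ : α → ℝ → ℝ} {s t C κ : ℝ} (hst : s ≤ t)
    (hd : ∀ x, ∀ r ∈ Set.Icc s t, HasDerivAt (d x) (δ x r) r)
    (hm : ∀ r ∈ Set.Icc s t, Measurable fun x => d x r)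
    (hs : Integrable (fun x => d x s) μ) (ht : Integrable (fun x => d x t) μ)
    (hδ : ∀ r ∈ Set.Icc s t, Integrable (fun x => δ x r) μ)
    (hC : ∀ r ∈ Set.Icc s t, ∫ x, |δ x r| ∂μ ≤ C)
    (hκ : ∀ r ∈ Set.Icc s t, ∫ x in {x | 0 < d x r}, δ x r ∂μ ≤ κ) :
    ∫ x, max (d x t) 0 ∂μ ≤ (∫ x, max (d x s) 0 ∂μ) + κ * (t - s) := by
  set D : ℝ → α → ℝ := fun r x => d x (max s (min r t)) with hD
  have hmem : ∀ r, max s (min r t) ∈ Set.Icc s t := fun r =>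
    ⟨le_max_left _ _, max_le hst (min_le_right _ _)⟩
  have hDr : ∀ r ∈ Set.Icc s t, ∀ x, D r x = d x r := fun r hr x => by
    simp only [hD, min_eq_left hr.2, max_eq_right hr.1]
  have hDc : ∀ x, Continuous fun r => D r x := fun x =>
    continuous_iff_continuousAt.2 fun r =>
      ContinuousAt.comp (f := fun r => max s (min r t)) (hd x _ (hmem r)).continuousAt (by fun_prop)
  have hDm : Measurable (Function.uncurry D) :=
    measurable_uncurry_of_continuous_of_measurable hDc fun r => hm _ (hmem r)
  set Q : ℝ × α → ℝ := Set.indicator (Set.Ioo s t ×ˢ Set.univ) (fun z => δ z.2 z.1) with hQ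
  have hset : MeasurableSet (Set.Ioo s t ×ˢ (Set.univ : Set α)) := measurableSet_Ioo.prod .univ
  have hQm : Measurable Q := by
    refine measurable_of_tendsto_metrizable (f := fun (m : ℕ) => Set.indicator
      (Set.Ioo s t ×ˢ Set.univ) fun z : ℝ × α => ((m : ℝ) + 1) *
        (Function.uncurry D (z.1 + 1 / ((m : ℝ) + 1), z.2) - Function.uncurry D z))
      (fun m => ?_) (tendsto_pi_nhds.2 fun z => ?_)
    · refine Measurable.indicator ?_ hset
      exact ((hDm.comp (by fun_prop)).sub hDm).const_mul _
    · by_cases hz : z ∈ Set.Ioo s t ×ˢ (Set.univ : Set α)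
      · simp only [hQ, Set.indicator_of_mem hz]
        obtain ⟨⟨hz1, hz2⟩, -⟩ := hz
        have h1 : Tendsto (fun m : ℕ => 1 / ((m : ℝ) + 1)) atTop (𝓝[≠] 0) :=
          tendsto_nhdsWithin_iff.2 ⟨tendsto_one_div_add_atTop_nhds_zero_nat,
            Eventually.of_forall fun m => by
              simp only [Set.mem_compl_iff, Set.mem_singleton_iff]; positivity⟩
        have h2 := (hasDerivAt_iff_tendsto_slope_zero.1 (hd z.2 z.1 ⟨hz1.le, hz2.le⟩)).comp h1
        refine h2.congr' ?_
        have h3 : ∀ᶠ m : ℕ in atTop, 1 / ((m : ℝ) + 1) < t - z.1 :=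
          tendsto_one_div_add_atTop_nhds_zero_nat.eventually (gt_mem_nhds (by linarith))
        filter_upwards [h3] with m hm3
        have h4 : 0 < 1 / ((m : ℝ) + 1) := by positivity
        simp only [Function.comp, smul_eq_mul, Function.uncurry]
        rw [hDr _ ⟨by linarith, by linarith⟩, hDr _ ⟨hz1.le, hz2.le⟩]
        simp
      · simp only [hQ, Set.indicator_of_notMem hz]
        exact tendsto_const_nhds
  set ν : Measure ℝ := volume.restrict (Set.Ioo s t) with hν
  have hQr : ∀ r ∈ Set.Ioo s t, ∀ x, Q (r, x) = δ x r := fun r hr x => by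
    simp only [hQ]
    rw [Set.indicator_of_mem (Set.mem_prod.2 ⟨hr, Set.mem_univ _⟩)]
  have hQi : Integrable Q (ν.prod μ) := by
    rw [integrable_prod_iff hQm.aestronglyMeasurable]
    constructor
    · refine (ae_restrict_iff' measurableSet_Ioo).2 (Eventually.of_forall fun r hr => ?_)
      simp_rw [hQr r hr]
      exact hδ r (Set.Ioo_subset_Icc_self hr)
    · refine Measure.integrableOn_of_bounded (M := C) (by simp)
        hQm.norm.aestronglyMeasurable.integral_prod_right'
        ((ae_restrict_iff' measurableSet_Ioo).2 (Eventually.of_forall fun r hr => ?_))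
      simp_rw [hQr r hr]
      rw [norm_of_nonneg (integral_nonneg fun x => norm_nonneg _)]
      exact hC r (Set.Ioo_subset_Icc_self hr)
  set P : ℝ × α → ℝ := Set.indicator {z | 0 < Function.uncurry D z} Q with hP
  have hPset : MeasurableSet {z | 0 < Function.uncurry D z} := measurableSet_lt measurable_const hDm
  have hPi : Integrable P (ν.prod μ) := hQi.indicator hPset
  have hPr : ∀ r ∈ Set.Ioo s t, ∀ x, P (r, x) = if 0 < d x r then δ x r else 0 := fun r hr x => by
    simp only [hP, Set.indicator_apply, Set.mem_ofPred_eq, Function.uncurry,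
      hDr r (Set.Ioo_subset_Icc_self hr), hQr r hr]
  have e1 : ∀ᵐ x ∂μ, max (d x t) 0 - max (d x s) 0 = ∫ r, P (r, x) ∂ν := by
    filter_upwards [hQi.prod_left_ae] with x hx
    have hi : IntervalIntegrable (δ x) volume s t := by
      rw [intervalIntegrable_iff_integrableOn_Ioo_of_le hst]
      exact IntegrableOn.congr_fun hx (fun r hr => hQr r hr x) measurableSet_Ioo
    rw [max_zero_sub_max_zero_eq_integral hst (hd x) hi, intervalIntegral.integral_of_le hst,
      integral_Ioc_eq_integral_Ioo]
    exact setIntegral_congr_fun measurableSet_Ioo fun r hr => (hPr r hr x).symm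
  have e2 : ∫ x, max (d x t) 0 ∂μ - ∫ x, max (d x s) 0 ∂μ = ∫ r, ∫ x, P (r, x) ∂μ ∂ν := by
    rw [← integral_sub ht.pos_part hs.pos_part, integral_congr_ae e1]
    exact (integral_integral_swap (f := fun r x => P (r, x)) hPi).symm
  have e3 : ∫ r, ∫ x, P (r, x) ∂μ ∂ν ≤ ∫ r in Set.Ioo s t, κ := by
    refine setIntegral_mono_on hPi.integral_prod_left (by simp) measurableSet_Ioo
      fun r hr => ?_
    have hr' := Set.Ioo_subset_Icc_self hr
    refine le_trans (le_of_eq ?_) (hκ r hr')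
    rw [← integral_indicator (measurableSet_lt measurable_const (hm r hr'))]
    refine integral_congr_ae (Eventually.of_forall fun x => ?_)
    simp only [hPr r hr, Set.indicator_apply, Set.mem_ofPred_eq]
  rw [setIntegral_const, measureReal_def, volume_Ioo, ENNReal.toReal_ofReal (by linarith),
    smul_eq_mul] at e3
  linarith

end IntegralLemmas

theorem lap_const_mul {n : ℕ} {f : EuclideanSpace ℝ (Fin n) → ℝ} (hf : ContDiff ℝ (⊤ : ℕ∞) f)
    (c : ℝ) (x : EuclideanSpace ℝ (Fin n)) : lap n (fun x => c * f x) x = c * lap n f x := by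
  have h : ∀ {g : EuclideanSpace ℝ (Fin n) → ℝ} (_ : ContDiff ℝ (⊤ : ℕ∞) g) (i : Fin n),
      pd i (fun x => c * g x) = fun x => c * pd i g x := fun hg i => by
    funext x
    unfold pd
    rw [fderiv_const_mul (hg.differentiable (by simp) x)]
    rfl
  rw [lap_eq_sum_pd (contDiff_const.mul hf), lap_eq_sum_pd hf, Finset.mul_sum]
  refine Finset.sum_congr rfl fun i _ => ?_
  rw [h hf, h (contDiff_pd i hf)]

/-- The `L¹` norm of `Δ(f^p)`. -/
def lapNorm {n : ℕ} (p : ℝ) (f : EuclideanSpace ℝ (Fin n) → ℝ) : ℝ :=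
  ∫ x, |lap n (fun y => f y ^ p) x|

theorem lapNorm_nonneg {n : ℕ} (p : ℝ) (f : EuclideanSpace ℝ (Fin n) → ℝ) : 0 ≤ lapNorm p f :=
  integral_nonneg fun _ => abs_nonneg _

/-- The properties of a fixed time slice of a solution. -/
structure TameDensity {n : ℕ} (k : ℕ) (f : EuclideanSpace ℝ (Fin n) → ℝ) : Prop where
  smooth : ContDiff ℝ (⊤ : ℕ∞) f
  pos : ∀ x, 0 < f x
  tame : ∃ N, TameBound N k f
  integrable : Integrable f

/-- A solution of `∂u/∂t = Δ(u^p)` on a compact time interval, along which the `L¹` norm of the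
time derivative is bounded. -/
structure IsSolOn {n : ℕ} (p : ℝ) (k : ℕ) (u : EuclideanSpace ℝ (Fin n) → ℝ → ℝ) (s t : ℝ) :
    Prop where
  tame : ∀ r ∈ Set.Icc s t, TameDensity k fun x => u x r
  pde : ∀ x, ∀ r ∈ Set.Icc s t, HasDerivAt (u x) (lap n (fun y => u y r ^ p) x) r
  bdd : ∃ C, ∀ r ∈ Set.Icc s t, lapNorm p (fun x => u x r) ≤ C

section Comparison

variable {n k : ℕ} {p : ℝ} {u w : EuclideanSpace ℝ (Fin n) → ℝ → ℝ} {s t : ℝ}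
  {f g : EuclideanSpace ℝ (Fin n) → ℝ}

theorem TameDensity.integrable_lap (hf : TameDensity k f) (hp : 1 < p)
    (hk : (n : ℝ) < k * (p - 1)) : Integrable (lap n fun x => f x ^ p) :=
  hf.tame.elim fun _ h => h.integrable_lap_rpow hf.smooth hf.pos hp hk

theorem TameDensity.kato (hf : TameDensity k f) (hg : TameDensity k g) (hp : 1 < p)
    (hk : (n : ℝ) < k * (p - 1)) :
    ∫ x in {x | 0 < f x - g x}, (lap n (fun x => f x ^ p) x - lap n (fun x => g x ^ p) x) ≤ 0 := by
  obtain ⟨N, hN⟩ := hf.tame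
  obtain ⟨N', hN'⟩ := hg.tame
  exact hN.setIntegral_lap_rpow_sub_nonpos hN' hf.smooth hg.smooth hf.pos hg.pos hp hk

theorem abs_setIntegral_lap_le (hf : TameDensity k f) (hp : 1 < p)
    (hk : (n : ℝ) < k * (p - 1)) (S : Set (EuclideanSpace ℝ (Fin n))) :
    |∫ x in S, lap n (fun x => f x ^ p) x| ≤ lapNorm p f :=
  (abs_integral_le_integral_abs).trans
    (setIntegral_le_integral (hf.integrable_lap hp hk).abs (Eventually.of_forall fun _ => abs_nonneg _))

/-- The `L¹` comparison principle. -/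
theorem IsSolOn.comparison (hu : IsSolOn p k u s t) (hw : IsSolOn p k w s t) (hp : 1 < p)
    (hk : (n : ℝ) < k * (p - 1)) (hst : s ≤ t) :
    ∫ x, max (u x t - w x t) 0 ≤ ∫ x, max (u x s - w x s) 0 := by
  obtain ⟨C, hC⟩ := hu.bdd
  obtain ⟨C', hC'⟩ := hw.bdd
  have hs : s ∈ Set.Icc s t := ⟨le_rfl, hst⟩
  have ht : t ∈ Set.Icc s t := ⟨hst, le_rfl⟩
  have := integral_max_zero_le (μ := volume) (d := fun x r => u x r - w x r)
    (δ := fun x r => lap n (fun y => u y r ^ p) x - lap n (fun y => w y r ^ p) x)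
    (C := C + C') (κ := 0) hst (fun x r hr => (hu.pde x r hr).sub (hw.pde x r hr))
    (fun r hr => ((hu.tame r hr).smooth.continuous.sub (hw.tame r hr).smooth.continuous).measurable)
    ((hu.tame s hs).integrable.sub (hw.tame s hs).integrable)
    ((hu.tame t ht).integrable.sub (hw.tame t ht).integrable)
    (fun r hr => ((hu.tame r hr).integrable_lap hp hk).sub ((hw.tame r hr).integrable_lap hp hk))
    (fun r hr => by
      have h1 := ((hu.tame r hr).integrable_lap hp hk).abs
      have h2 := ((hw.tame r hr).integrable_lap hp hk).abs
      refine le_trans ?_ (add_le_add (hC r hr) (hC' r hr))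
      unfold lapNorm
      rw [← integral_add h1 h2]
      exact integral_mono (((hu.tame r hr).integrable_lap hp hk).sub
        ((hw.tame r hr).integrable_lap hp hk)).abs (h1.add h2) fun x => abs_sub _ _)
    (fun r hr => (hu.tame r hr).kato (hw.tame r hr) hp hk)
  simpa using this

theorem integral_abs_sub_eq {α : Type*} [MeasurableSpace α] {μ : Measure α} {f g : α → ℝ}
    (hf : Integrable f μ) (hg : Integrable g μ) :
    ∫ x, |f x - g x| ∂μ = ∫ x, max (f x - g x) 0 ∂μ + ∫ x, max (g x - f x) 0 ∂μ := by
  rw [← integral_add (f := fun x => max (f x - g x) 0) (g := fun x => max (g x - f x) 0)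
    (hf.sub hg).pos_part (hg.sub hf).pos_part]
  refine integral_congr_ae (Eventually.of_forall fun x => ?_)
  beta_reduce
  rcases le_total (f x) (g x) with h | h
  · rw [abs_of_nonpos (by linarith), max_eq_right (by linarith), max_eq_left (by linarith)]; ring
  · rw [abs_of_nonneg (by linarith), max_eq_left (by linarith), max_eq_right (by linarith)]; ring

theorem IsSolOn.contraction (hu : IsSolOn p k u s t) (hw : IsSolOn p k w s t) (hp : 1 < p)
    (hk : (n : ℝ) < k * (p - 1)) (hst : s ≤ t) :
    ∫ x, |u x t - w x t| ≤ ∫ x, |u x s - w x s| := by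
  have hs : s ∈ Set.Icc s t := ⟨le_rfl, hst⟩
  have ht : t ∈ Set.Icc s t := ⟨hst, le_rfl⟩
  rw [integral_abs_sub_eq (hu.tame t ht).integrable (hw.tame t ht).integrable,
    integral_abs_sub_eq (hu.tame s hs).integrable (hw.tame s hs).integrable]
  exact add_le_add (hu.comparison hw hp hk hst) (hw.comparison hu hp hk hst)

/-- Comparison of a solution with a fixed profile. -/
theorem IsSolOn.integral_abs_sub_le (hu : IsSolOn p k u s t) (hg : TameDensity k g) (hp : 1 < p)
    (hk : (n : ℝ) < k * (p - 1)) (hst : s ≤ t) :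
    ∫ x, |u x t - g x| ≤ (∫ x, |u x s - g x|) + 2 * lapNorm p g * (t - s) := by
  obtain ⟨C, hC⟩ := hu.bdd
  have hs : s ∈ Set.Icc s t := ⟨le_rfl, hst⟩
  have ht : t ∈ Set.Icc s t := ⟨hst, le_rfl⟩
  have hi := fun r hr => (hu.tame r hr).integrable_lap hp hk
  have h1 := integral_max_zero_le (μ := volume) (d := fun x r => u x r - g x)
    (δ := fun x r => lap n (fun y => u y r ^ p) x)
    (C := C) (κ := lapNorm p g) hst (fun x r hr => (hu.pde x r hr).sub_const (g x))
    (fun r hr => ((hu.tame r hr).smooth.continuous.sub hg.smooth.continuous).measurable)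
    ((hu.tame s hs).integrable.sub hg.integrable)
    ((hu.tame t ht).integrable.sub hg.integrable) hi hC
    (fun r hr => by
      have h1 := (hu.tame r hr).kato hg hp hk
      have h2 := (abs_le.1 (abs_setIntegral_lap_le hg hp hk {x | 0 < u x r - g x})).2
      rw [integral_sub (hi r hr).integrableOn (hg.integrable_lap hp hk).integrableOn] at h1
      linarith)
  have h2 := integral_max_zero_le (μ := volume) (d := fun x r => g x - u x r)
    (δ := fun x r => -lap n (fun y => u y r ^ p) x)
    (C := C) (κ := lapNorm p g) hst (fun x r hr => (hu.pde x r hr).const_sub (g x))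
    (fun r hr => (hg.smooth.continuous.sub (hu.tame r hr).smooth.continuous).measurable)
    (hg.integrable.sub (hu.tame s hs).integrable)
    (hg.integrable.sub (hu.tame t ht).integrable) (fun r hr => (hi r hr).neg)
    (fun r hr => by simp_rw [abs_neg]; exact hC r hr)
    (fun r hr => by
      have h1 := hg.kato (hu.tame r hr) hp hk
      have h2 := (abs_le.1 (abs_setIntegral_lap_le hg hp hk {x | 0 < g x - u x r})).1
      rw [integral_sub (hg.integrable_lap hp hk).integrableOn (hi r hr).integrableOn] at h1
      rw [integral_neg]
      linarith)
  rw [integral_abs_sub_eq (hu.tame t ht).integrable hg.integrable,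
    integral_abs_sub_eq (hu.tame s hs).integrable hg.integrable]
  linarith

theorem IsSolOn.comp_add_const {h : ℝ} (hu : IsSolOn p k u (s + h) (t + h)) :
    IsSolOn p k (fun x r => u x (r + h)) s t where
  tame r hr := hu.tame (r + h) ⟨by linarith [hr.1], by linarith [hr.2]⟩
  pde x r hr := (hu.pde x (r + h) ⟨by linarith [hr.1], by linarith [hr.2]⟩).comp_add_const r h
  bdd := hu.bdd.imp fun _ hC r hr => hC (r + h) ⟨by linarith [hr.1], by linarith [hr.2]⟩

/-- The scaling `c u(x, s + c^(p-1) (r - s))` of a solution is a solution. -/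
theorem IsSolOn.scale {c : ℝ} (hu : IsSolOn p k u s t) (hc : 0 < c) (hc1 : c ≤ 1) (hp : 1 < p) :
    IsSolOn p k (fun x r => c * u x (s + c ^ (p - 1) * (r - s))) s t := by
  have hq : 0 < c ^ (p - 1) := rpow_pos_of_pos hc _
  have hq1 : c ^ (p - 1) ≤ 1 := rpow_le_one hc.le hc1 (by linarith)
  have hmem : ∀ r ∈ Set.Icc s t, s + c ^ (p - 1) * (r - s) ∈ Set.Icc s t := fun r hr => by
    have h0 : 0 ≤ r - s := by linarith [hr.1]
    constructor <;> nlinarith [hr.2, mul_nonneg hq.le h0]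
  have hl : ∀ r ∈ Set.Icc s t, ∀ x,
      lap n (fun y => (c * u y (s + c ^ (p - 1) * (r - s))) ^ p) x =
        c ^ p * lap n (fun y => u y (s + c ^ (p - 1) * (r - s)) ^ p) x := fun r hr x => by
    have h := hu.tame _ (hmem r hr)
    rw [← lap_const_mul (contDiff_rpow_of_pos h.smooth h.pos p)]
    simp_rw [mul_rpow hc.le (h.pos _).le]
  refine ⟨fun r hr => ?_, fun x r hr => ?_, ?_⟩
  · obtain ⟨h1, h2, ⟨N, h3⟩, h4⟩ := hu.tame _ (hmem r hr)
    refine ⟨contDiff_const.mul h1, fun x => mul_pos hc (h2 x), ⟨c * N, fun x => ?_, fun x i a => ?_⟩,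
      h4.const_mul c⟩
    · have := mul_le_mul_of_nonneg_left (h3.decay x) hc.le
      linarith
    · have := mul_le_mul_of_nonneg_left (h3.symm_diff x i a) hc.le
      rw [← abs_of_pos hc, ← abs_mul, abs_of_pos hc] at this
      rw [mul_assoc]
      refine le_trans (le_of_eq (congrArg _ ?_)) this
      ring
  · have h1 : HasDerivAt (fun r => s + c ^ (p - 1) * (r - s)) (c ^ (p - 1)) r := by
      simpa using (((hasDerivAt_id r).sub_const s).const_mul (c ^ (p - 1))).const_add s
    have h2 := ((hu.pde x _ (hmem r hr)).comp r h1).const_mul c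
    refine h2.congr_deriv ?_
    rw [hl r hr, show c ^ p = c * c ^ (p - 1) by rw [← rpow_one_add' hc.le (by linarith)]; ring_nf]
    ring
  · obtain ⟨C, hC⟩ := hu.bdd
    refine ⟨c ^ p * C, fun r hr => ?_⟩
    have hcp : 0 < c ^ p := rpow_pos_of_pos hc _
    unfold lapNorm
    simp_rw [hl r hr, abs_mul, abs_of_pos hcp]
    rw [integral_const_mul]
    exact mul_le_mul_of_nonneg_left (hC _ (hmem r hr)) hcp.le

end Comparison

/-- A solution of `∂v/∂t = Δ(v^p)` for all positive times with unit mass. -/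
structure IsGlobalSol {n : ℕ} (p : ℝ) (k : ℕ) (v : EuclideanSpace ℝ (Fin n) → ℝ → ℝ) : Prop where
  tame : ∀ t > 0, TameDensity k fun x => v x t
  pde : ∀ x, ∀ t > 0, HasDerivAt (v x) (lap n (fun y => v y t ^ p) x) t
  mass : ∀ t > 0, ∫ x, v x t = 1

namespace IsGlobalSol

variable {n k : ℕ} {p : ℝ} {v : EuclideanSpace ℝ (Fin n) → ℝ → ℝ} {a b s t : ℝ}

theorem isSolOn (hv : IsGlobalSol p k v) (hs : 0 < s)
    (hb : ∃ C, ∀ r ∈ Set.Icc s t, lapNorm p (fun x => v x r) ≤ C) : IsSolOn p k v s t where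
  tame r hr := hv.tame r (hs.trans_le hr.1)
  pde x r hr := hv.pde x r (hs.trans_le hr.1)
  bdd := hb

theorem tendsto_integral_abs_sub (hv : IsGlobalSol p k v) (ht : 0 < t) :
    Tendsto (fun s => ∫ x, |v x s - v x t|) (𝓝 t) (𝓝 0) := by
  have hpos : ∀ᶠ s in 𝓝 t, 0 < s := lt_mem_nhds ht
  refine tendsto_integral_abs_sub_of_tendsto_integral (F := fun s x => v x s)
    (hpos.mono fun s hs => (hv.tame s hs).integrable) (hv.tame t ht).integrable
    (hpos.mono fun s hs x => ((hv.tame s hs).pos x).le)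
    (fun x => (hv.pde x t ht).continuousAt) ?_
  refine tendsto_const_nhds.congr' ?_
  filter_upwards [hpos] with s hs
  rw [hv.mass s hs, hv.mass t ht]

theorem tendsto_integral_abs_shift (hv : IsGlobalSol p k v) {h : ℝ} (ha : 0 < a) (hh : 0 ≤ h) :
    Tendsto (fun s => ∫ x, |v x (s + h) - v x s|) (𝓝[>] a) (𝓝 (∫ x, |v x (a + h) - v x a|)) := by
  have hpos : ∀ᶠ s in 𝓝[>] a, 0 < s := nhdsWithin_le_nhds (lt_mem_nhds ha)
  have hah : 0 < a + h := by linarith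
  have t1 : Tendsto (fun s => s + h) (𝓝[>] a) (𝓝 (a + h)) :=
    ((continuous_id.add continuous_const).tendsto a).mono_left nhdsWithin_le_nhds
  have h1 := ((hv.tendsto_integral_abs_sub hah).comp t1).add
    ((hv.tendsto_integral_abs_sub ha).mono_left nhdsWithin_le_nhds)
  rw [add_zero] at h1
  rw [tendsto_iff_dist_tendsto_zero]
  refine squeeze_zero' (Eventually.of_forall fun _ => dist_nonneg) ?_ h1
  filter_upwards [hpos] with s hs
  have i := fun r (hr : 0 < r) => (hv.tame r hr).integrable
  have i1 := ((i _ (show 0 < s + h by linarith)).sub (i s hs)).abs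
  have i2 := ((i _ hah).sub (i a ha)).abs
  have i3 := ((i _ (show 0 < s + h by linarith)).sub (i _ hah)).abs
  have i4 := ((i s hs).sub (i a ha)).abs
  rw [Real.dist_eq, ← integral_sub (f := fun x => |v x (s + h) - v x s|)
    (g := fun x => |v x (a + h) - v x a|) i1 i2, Function.comp_apply,
    ← integral_add (f := fun x => |v x (s + h) - v x (a + h)|) (g := fun x => |v x s - v x a|) i3 i4]
  refine abs_integral_le_integral_abs.trans (integral_mono (i1.sub i2).abs (i3.add i4) fun x => ?_)
  calc |(|v x (s + h) - v x s| - |v x (a + h) - v x a|)|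
      ≤ |(v x (s + h) - v x s) - (v x (a + h) - v x a)| := abs_abs_sub_abs_le _ _
    _ = |(v x (s + h) - v x (a + h)) - (v x s - v x a)| := by congr 1; ring
    _ ≤ _ := abs_sub _ _

/-- The `L¹` norm of the time derivative at `t` is controlled by its value at an earlier time `a`
as soon as it is locally bounded on `(a, b) ∋ t`. -/
theorem lapNorm_le_two_mul (hv : IsGlobalSol p k v) (hp : 1 < p)
    (hk : (n : ℝ) < k * (p - 1)) (ha : 0 < a)
    (hb : ∀ s ∈ Set.Ioo a b, ∀ t ∈ Set.Ioo a b,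
      ∃ C, ∀ r ∈ Set.Icc s t, lapNorm p (fun x => v x r) ≤ C) (ht : t ∈ Set.Ioo a b) :
    lapNorm p (fun x => v x t) ≤ 2 * lapNorm p (fun x => v x a) := by
  have t0 : 0 < t := ha.trans ht.1
  have sol : ∀ s ∈ Set.Ioo a b, ∀ t ∈ Set.Ioo a b, IsSolOn p k v s t := fun s hs t ht =>
    hv.isSolOn (ha.trans hs.1) (hb s hs t ht)
  have c2 : ∀ r ∈ Set.Ioo a b,
      ∫ x, |v x r - v x a| ≤ 2 * lapNorm p (fun x => v x a) * (r - a) := fun r hr => by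
    have l1 : Tendsto (fun s => (∫ x, |v x s - v x a|) + 2 * lapNorm p (fun x => v x a) * (r - s))
        (𝓝[>] a) (𝓝 (0 + 2 * lapNorm p (fun x => v x a) * (r - a))) :=
      ((hv.tendsto_integral_abs_sub ha).mono_left nhdsWithin_le_nhds).add
        ((Continuous.tendsto (by fun_prop) a).mono_left nhdsWithin_le_nhds)
    rw [zero_add] at l1
    refine ge_of_tendsto l1 ?_
    filter_upwards [Ioo_mem_nhdsGT hr.1] with s hs
    exact (sol s ⟨hs.1, hs.2.trans hr.2⟩ r hr).integral_abs_sub_le (hv.tame a ha) hp hk hs.2.le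
  have c1 : ∀ h > 0, t + h < b →
      ∫ x, |v x (t + h) - v x t| ≤ 2 * lapNorm p (fun x => v x a) * h := fun h hh htb => by
    refine le_trans ?_ ((c2 (a + h) ⟨by linarith, by linarith [ht.1]⟩).trans_eq (by ring))
    refine ge_of_tendsto (hv.tendsto_integral_abs_shift ha hh.le) ?_
    filter_upwards [Ioo_mem_nhdsGT ht.1] with s hs
    have hs' : s ∈ Set.Ioo a b := ⟨hs.1, hs.2.trans ht.2⟩
    exact (sol (s + h) ⟨by linarith [hs.1], by linarith [hs.2]⟩ (t + h)
      ⟨by linarith [ht.1], htb⟩).comp_add_const.contraction (sol s hs' t ht) hp hk hs.2.le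
  have iL := ((hv.tame t t0).integrable_lap hp hk).abs
  set L := lap n fun y => v y t ^ p
  have lim : Tendsto (fun h => ∫ x, min (|v x (t + h) - v x t| / h) |L x|) (𝓝[>] 0)
      (𝓝 (∫ x, |L x|)) := by
    have hpos : ∀ᶠ h : ℝ in 𝓝[>] 0, 0 < h := self_mem_nhdsWithin
    refine tendsto_integral_filter_of_dominated_convergence (fun x => |L x|) ?_ ?_ iL
      (Eventually.of_forall fun x => ?_)
    · filter_upwards [hpos] with h hh
      have hc1 := (hv.tame (t + h) (by linarith)).smooth.continuous
      have hc2 := (hv.tame t t0).smooth.continuous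
      exact (((hc1.sub hc2).abs.div_const h).aestronglyMeasurable).inf iL.aestronglyMeasurable
    · filter_upwards [hpos] with h hh
      refine Eventually.of_forall fun x => ?_
      rw [norm_of_nonneg (le_min (by positivity) (abs_nonneg _))]
      exact min_le_right _ _
    · have h1 := (hasDerivAt_iff_tendsto_slope_zero.1 (hv.pde x t t0)).mono_left
        (nhdsWithin_mono (0 : ℝ) (fun y (hy : 0 < y) => hy.ne'))
      have h2 := h1.abs.min (tendsto_const_nhds (x := |L x|))
      rw [min_self] at h2
      refine h2.congr' ?_
      filter_upwards [hpos] with h hh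
      rw [smul_eq_mul, abs_mul, abs_inv, abs_of_pos hh, inv_mul_eq_div]
  refine le_of_tendsto lim ?_
  filter_upwards [Ioo_mem_nhdsGT (show 0 < b - t by linarith [ht.2])] with h hh
  have hi := ((hv.tame (t + h) (by linarith [hh.1])).integrable.sub (hv.tame t t0).integrable).abs
  have h0 := hh.1
  calc ∫ x, min (|v x (t + h) - v x t| / h) |L x| ≤ ∫ x, |v x (t + h) - v x t| / h :=
        integral_mono ((hi.div_const h).inf iL) (hi.div_const h) fun x => min_le_left _ _
    _ = (∫ x, |v x (t + h) - v x t|) / h := integral_div _ _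
    _ ≤ _ := by rw [div_le_iff₀ h0]; exact c1 h h0 (by linarith [hh.2])

theorem exists_bound_of_locally_bounded {A : ℝ → ℝ} {K : Set ℝ} (hK : IsCompact K)
    (h : ∀ t ∈ K, ∃ C, ∀ᶠ s in 𝓝 t, A s ≤ C) : ∃ C, ∀ s ∈ K, A s ≤ C := by
  refine hK.induction_on (p := fun S => ∃ C, ∀ s ∈ S, A s ≤ C) ⟨0, by simp⟩
    (fun S T hST ⟨C, hC⟩ => ⟨C, fun s hs => hC s (hST hs)⟩)
    (fun S T ⟨C, hC⟩ ⟨D, hD⟩ => ⟨max C D, ?_⟩) fun t ht => ?_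
  · rintro s (hs | hs)
    · exact (hC s hs).trans (le_max_left _ _)
    · exact (hD s hs).trans (le_max_right _ _)
  · obtain ⟨C, hC⟩ := h t ht
    exact ⟨_, mem_nhdsWithin_of_mem_nhds hC, C, fun s hs => hs⟩

theorem exists_lapNorm_le (hv : IsGlobalSol p k v) (hp : 1 < p) (hk : (n : ℝ) < k * (p - 1))
    (ht : 0 < t) : ∃ C, ∀ᶠ s in 𝓝 t, lapNorm p (fun x => v x s) ≤ C := by
  set A : ℝ → ℝ := fun s => lapNorm p fun x => v x s with hA
  set U : Set ℝ := {t | ∃ C, ∀ᶠ s in 𝓝 t, A s ≤ C} with hU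
  have hUo : IsOpen U := isOpen_iff_mem_nhds.2 fun t ⟨C, hC⟩ =>
    (eventually_eventually_nhds.2 hC).mono fun s hs => ⟨C, hs⟩
  by_contra hcon
  set Z : Set ℝ := Uᶜ ∩ Set.Ioi 0 with hZ
  have hZlc : IsLocallyClosed Z := hUo.isClosed_compl.isLocallyClosed.inter isOpen_Ioi.isLocallyClosed
  have : LocallyCompactSpace Z := hZlc.locallyCompactSpace
  have : Nonempty Z := ⟨⟨t, hcon, ht⟩⟩
  obtain ⟨N, z0, hz0⟩ := nonempty_interior_of_iUnion_of_closed
    (f := fun N : ℕ => {z : Z | TameBound N k fun x => v x z}) (fun N => by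
      refine IsSeqClosed.isClosed fun z z' hz hlim => ?_
      have hl : Tendsto (fun j => (z j : ℝ)) atTop (𝓝 (z' : ℝ)) :=
        (continuous_subtype_val.tendsto _).comp hlim
      exact TameBound.of_tendsto (l := atTop) (F := fun j x => v x (z j))
        (Eventually.of_forall hz)
        fun x => (hv.pde x z' z'.2.2).continuousAt.tendsto.comp hl) (by
      refine Set.eq_univ_of_forall fun z => ?_
      obtain ⟨N, hN⟩ := (hv.tame z z.2.2).tame
      obtain ⟨M, hM⟩ := exists_nat_ge N
      exact Set.mem_iUnion.2 ⟨M, hN.mono hM⟩)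
  rw [mem_interior_iff_mem_nhds, nhds_subtype, mem_comap] at hz0
  obtain ⟨O, hO, hOs⟩ := hz0
  obtain ⟨ε, hε, hball⟩ := Metric.mem_nhds_iff.1
    (inter_mem hO (isOpen_Ioi.mem_nhds z0.2.2 : Set.Ioi 0 ∈ 𝓝 (z0 : ℝ)))
  set C := n * (p * N + p * (p - 1) * (2 * N)) * ((N : ℝ) ^ (p - 1) *
      ∫ x : EuclideanSpace ℝ (Fin n), (1 + ‖x‖) ^ (-(k * (p - 1))))
  have hCZ : ∀ z ∈ Z, z ∈ Metric.ball (z0 : ℝ) ε → A z ≤ C := fun z hz hzb =>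
    TameBound.integral_abs_lap_rpow_le (hOs (show (⟨z, hz⟩ : Z) ∈ _ from (hball hzb).1))
      (hv.tame z hz.2).smooth (hv.tame z hz.2).pos hp hk
  set s0 : ℝ := z0 - ε / 2 with hs0
  have hz0pos : (0 : ℝ) < z0 := z0.2.2
  have hbd : ∀ t ∈ Set.Ico s0 (z0 + ε), t ∈ Metric.ball (z0 : ℝ) ε := fun t ht => by
    rw [Metric.mem_ball, Real.dist_eq, abs_lt]
    constructor <;> linarith [ht.1, ht.2]
  have hs0pos : 0 < s0 := (hball (hbd s0 ⟨le_rfl, by linarith⟩)).2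
  refine z0.2.1 ⟨2 * max C (A s0), ?_⟩
  have hmax0 : 0 ≤ max C (A s0) := (lapNorm_nonneg _ _).trans (le_max_right _ _)
  filter_upwards [Ioo_mem_nhds (show s0 < z0 by linarith) (show (z0 : ℝ) < z0 + ε by linarith)]
    with t ht
  by_cases htZ : t ∈ Z
  · have := (hCZ t htZ (hbd t ⟨ht.1.le, ht.2⟩)).trans (le_max_left C (A s0))
    linarith
  have htU : t ∈ U := by
    by_contra h
    exact htZ ⟨h, hs0pos.trans ht.1⟩
  set S : Set ℝ := (Uᶜ ∪ {s0}) ∩ Set.Icc s0 t with hS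
  have hSc : IsCompact S := isCompact_Icc.inter_left (hUo.isClosed_compl.union isClosed_singleton)
  have hSn : S.Nonempty := ⟨s0, Or.inr rfl, le_rfl, ht.1.le⟩
  have haS := hSc.sSup_mem hSn
  set a := sSup S
  have ha0 : 0 < a := hs0pos.trans_le haS.2.1
  have hat : a < t := lt_of_le_of_ne haS.2.2 fun h => by
    rcases haS.1 with h1 | h1
    · exact h1 (h ▸ htU)
    · exact ht.1.ne' (h ▸ h1)
  have hUa : ∀ r, a < r → r ≤ t → r ∈ U := fun r h1 h2 => by
    by_contra h
    exact h1.not_ge (le_csSup hSc.bddAbove ⟨Or.inl h, haS.2.1.trans h1.le, h2⟩)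
  obtain ⟨η, hη, hηU⟩ := Metric.mem_nhds_iff.1 (hUo.mem_nhds htU)
  have hUab : ∀ r ∈ Set.Ioo a (t + η), r ∈ U := fun r hr => by
    rcases le_or_gt r t with h | h
    · exact hUa r hr.1 h
    · refine hηU ?_
      rw [Metric.mem_ball, Real.dist_eq, abs_lt]
      constructor <;> linarith [hr.2]
  have key := hv.lapNorm_le_two_mul (a := a) (b := t + η) (t := t) hp hk ha0
    (fun s hs t ht => exists_bound_of_locally_bounded isCompact_Icc fun r hr =>
      hUab r ⟨hs.1.trans_le hr.1, hr.2.trans_lt ht.2⟩) ⟨hat, by linarith⟩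
  have haA : A a ≤ max C (A s0) := by
    rcases haS.1 with h1 | h1
    · exact (hCZ a ⟨h1, ha0⟩ (hbd a ⟨haS.2.1, hat.trans ht.2⟩)).trans (le_max_left _ _)
    · rw [Set.mem_singleton_iff.1 h1]; exact le_max_right _ _
  exact key.trans (mul_le_mul_of_nonneg_left haA zero_le_two)

theorem isSolOn_of_pos (hv : IsGlobalSol p k v) (hp : 1 < p) (hk : (n : ℝ) < k * (p - 1))
    (hs : 0 < s) : IsSolOn p k v s t :=
  hv.isSolOn hs (exists_bound_of_locally_bounded isCompact_Icc fun _ hr =>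
    hv.exists_lapNorm_le hp hk (hs.trans_le hr.1))

end IsGlobalSol

theorem tendsto_integral_of_abs_le {α ι : Type*} [MeasurableSpace α] {μ : Measure α}
    {l : Filter ι} [l.IsCountablyGenerated] {F Q : ι → α → ℝ} {f q : α → ℝ} {K : ℝ} (hK : 0 ≤ K)
    (hF : ∀ᶠ j in l, Integrable (F j) μ) (hQ : ∀ᶠ j in l, Integrable (Q j) μ)
    (hq : Integrable q μ) (hle : ∀ᶠ j in l, ∀ x, |F j x| ≤ K * |Q j x|)
    (hlimF : ∀ x, Tendsto (fun j => F j x) l (𝓝 (f x))) (hf : ∀ x, |f x| ≤ K * |q x|)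
    (hL : Tendsto (fun j => ∫ x, |Q j x - q x| ∂μ) l (𝓝 0)) :
    Tendsto (fun j => ∫ x, F j x ∂μ) l (𝓝 (∫ x, f x ∂μ)) := by
  set G : ι → α → ℝ := fun j x => max (min (F j x) (K * |q x|)) (-(K * |q x|)) with hG
  have hKq : Integrable (fun x => K * |q x|) μ := hq.abs.const_mul K
  have hGi : ∀ j, Integrable (F j) μ → Integrable (G j) μ := fun j hj => (hj.inf hKq).sup hKq.neg
  have h1 : Tendsto (fun j => ∫ x, G j x ∂μ) l (𝓝 (∫ x, f x ∂μ)) := by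
    refine tendsto_integral_filter_of_dominated_convergence (fun x => K * |q x|) ?_ ?_ hKq
      (Eventually.of_forall fun x => ?_)
    · filter_upwards [hF] with j hj using (hGi j hj).aestronglyMeasurable
    · refine Eventually.of_forall fun j => Eventually.of_forall fun x => ?_
      have : 0 ≤ K * |q x| := by positivity
      rw [Real.norm_eq_abs, abs_le]
      exact ⟨le_max_right _ _, max_le (min_le_right _ _) (by linarith)⟩
    · have := ((hlimF x).min (tendsto_const_nhds (x := K * |q x|))).max
        (tendsto_const_nhds (x := -(K * |q x|)))
      rwa [min_eq_left (abs_le.1 (hf x)).2, max_eq_left (abs_le.1 (hf x)).1] at this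
  have h2 : Tendsto (fun j => ∫ x, (F j x - G j x) ∂μ) l (𝓝 0) := by
    have h3 := hL.const_mul K
    rw [mul_zero] at h3
    refine squeeze_zero_norm' ?_ h3
    filter_upwards [hF, hQ, hle] with j hj hQj hlej
    rw [← integral_const_mul, Real.norm_eq_abs]
    refine abs_integral_le_integral_abs.trans (integral_mono (hj.sub (hGi j hj)).abs
      ((hQj.sub hq).abs.const_mul K) fun x => ?_)
    have a1 := abs_le.1 (hlej x)
    have a2 : K * |Q j x| ≤ K * |q x| + K * |Q j x - q x| := by
      rw [← mul_add]
      refine mul_le_mul_of_nonneg_left ?_ hK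
      linarith [abs_sub_abs_le_abs_sub (Q j x) (q x)]
    have a3 : 0 ≤ K * |q x| := by positivity
    have a4 : 0 ≤ K * |Q j x - q x| := by positivity
    simp only [hG]
    rcases le_total (F j x) (K * |q x|) with h | h
    · rw [min_eq_left h]
      rcases le_total (F j x) (-(K * |q x|)) with h' | h'
      · rw [max_eq_right h', abs_le]; constructor <;> linarith
      · rw [max_eq_left h', sub_self, abs_zero]; exact a4
    · rw [min_eq_right h, max_eq_left (by linarith), abs_le]
      constructor <;> linarith
  have h4 := h1.add h2
  rw [add_zero] at h4
  refine h4.congr' ?_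
  filter_upwards [hF] with j hj
  rw [integral_sub hj (hGi j hj)]
  ring

theorem abs_rpow_sub_rpow_le {p M a b : ℝ} (hp : 1 < p) (ha : 0 ≤ a) (haM : a ≤ M) (hb : 0 ≤ b)
    (hbM : b ≤ M) : |a ^ p - b ^ p| ≤ p * M ^ (p - 1) * |a - b| :=
  (convex_Icc 0 M).norm_image_sub_le_of_norm_hasDerivWithin_le (f := fun x : ℝ => x ^ p)
    (f' := fun x => p * x ^ (p - 1)) (C := p * M ^ (p - 1))
    (fun x _ => (hasDerivAt_rpow_const (Or.inr hp.le)).hasDerivWithinAt)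
    (fun x hx => by
      rw [norm_of_nonneg (mul_nonneg (by linarith) (rpow_nonneg hx.1 _))]
      exact mul_le_mul_of_nonneg_left (rpow_le_rpow hx.1 hx.2 (by linarith)) (by linarith))
    ⟨hb, hbM⟩ ⟨ha, haM⟩

namespace IsGlobalSol

variable {n k : ℕ} {p : ℝ} {v : EuclideanSpace ℝ (Fin n) → ℝ → ℝ} {s t τ : ℝ}

/-- The **Bénilan–Crandall** monotonicity of `(t - s)^(1/(p-1)) v(x,t)`. -/
theorem mul_le_of_le (hv : IsGlobalSol p k v) (hp : 1 < p) (hk : (n : ℝ) < k * (p - 1))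
    (hs : 0 < s) (hsτ : s < τ) (hτt : τ ≤ t) (x : EuclideanSpace ℝ (Fin n)) :
    ((τ - s) / (t - s)) ^ (1 / (p - 1)) * v x τ ≤ v x t := by
  have hst : s < t := hsτ.trans_le hτt
  have h0 : 0 < (τ - s) / (t - s) := div_pos (by linarith) (by linarith)
  have h1 : (τ - s) / (t - s) ≤ 1 := (div_le_one (by linarith)).2 (by linarith)
  set c := ((τ - s) / (t - s)) ^ (1 / (p - 1))
  have hp' : 0 < p - 1 := by linarith
  have hc : 0 < c := rpow_pos_of_pos h0 _
  have hc1 : c ≤ 1 := rpow_le_one h0.le h1 (by positivity)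
  have hcp : c ^ (p - 1) = (τ - s) / (t - s) := by
    rw [← rpow_mul h0.le, one_div_mul_cancel hp'.ne', rpow_one]
  have sol : IsSolOn p k v s t := hv.isSolOn_of_pos hp hk hs
  have key := (sol.scale hc hc1 hp).comparison sol hp hk hst.le
  beta_reduce at key
  have e : s + c ^ (p - 1) * (t - s) = τ := by
    rw [hcp, div_mul_cancel₀ _ (by linarith)]; ring
  simp only [e, sub_self, mul_zero, add_zero] at key
  have z : ∫ x, max (c * v x s - v x s) 0 = 0 := by
    refine integral_eq_zero_of_ae (Eventually.of_forall fun x => ?_)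
    have := (hv.tame s hs).pos x
    exact max_eq_right (by nlinarith [mul_le_mul_of_nonneg_right hc1 this.le])
  rw [z] at key
  have hτ := hv.tame τ (hs.trans hsτ)
  have ht := hv.tame t (hs.trans hst)
  have hcont : Continuous fun x => max (c * v x τ - v x t) 0 :=
    ((continuous_const.mul hτ.smooth.continuous).sub ht.smooth.continuous).max continuous_const
  have hzero := (integral_eq_zero_iff_of_nonneg (fun x => le_max_right _ _)
    ((hτ.integrable.const_mul c).sub ht.integrable).pos_part).1
    (le_antisymm key (integral_nonneg fun x => le_max_right _ _))
  have := congrFun ((hcont.ae_eq_iff_eq volume continuous_const).1 hzero) x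
  have h2 := (le_max_left _ _).trans_eq this
  exact sub_nonpos.1 h2

theorem tendsto_integral_abs_slope_sub (hv : IsGlobalSol p k v) (hp : 1 < p)
    (hk : (n : ℝ) < k * (p - 1)) (ht : 0 < t) :
    Tendsto (fun r => ∫ x, |slope (v x) t r - lap n (fun y => v y t ^ p) x|) (𝓝[≠] t) (𝓝 0) := by
  set L := lap n fun y => v y t ^ p
  have hLi : Integrable L := (hv.tame t ht).integrable_lap hp hk
  have hL0 : ∫ x, L x = 0 := by
    obtain ⟨N, hN⟩ := (hv.tame t ht).tame
    exact hN.integral_lap_rpow (hv.tame t ht).smooth (hv.tame t ht).pos hp hk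
  set ρ : ℝ → ℝ := fun r => ((t - t / 2) / (r - t / 2)) ^ (1 / (p - 1)) with hρ
  have hρt : ρ t = 1 := by simp only [hρ]; rw [div_self (by linarith), one_rpow]
  obtain ⟨β, hβ⟩ : ∃ β, HasDerivAt ρ β t := by
    have h1 : HasDerivAt (fun r => (t - t / 2) / (r - t / 2)) _ t :=
      (hasDerivAt_const t (t - t / 2)).div ((hasDerivAt_id t).sub_const (t / 2))
        (by change t - t / 2 ≠ 0; linarith)
    exact ⟨_, h1.rpow_const (Or.inl (by rw [div_self (by linarith)]; norm_num))⟩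
  have hβl := hasDerivAt_iff_tendsto_slope.1 hβ
  have hnear : ∀ᶠ r in 𝓝[≠] t, t / 2 < r ∧ r ≠ t :=
    ((lt_mem_nhds (half_lt_self ht)).filter_mono nhdsWithin_le_nhds).and self_mem_nhdsWithin
  have i := fun r (hr : 0 < r) => (hv.tame r hr).integrable
  have si : ∀ r, 0 < r → Integrable fun x => slope (v x) t r := fun r hr => by
    simp_rw [slope_def_field]
    exact ((i r hr).sub (i t ht)).div_const _
  have sint : ∀ r, 0 < r → ∫ x, slope (v x) t r = 0 := fun r hr => by
    simp_rw [slope_def_field]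
    rw [integral_div, integral_sub (i r hr) (i t ht), hv.mass r hr, hv.mass t ht, sub_self, zero_div]
  have hS := tendsto_integral_abs_sub_of_tendsto_integral (μ := volume) (l := 𝓝[≠] t)
    (F := fun r x => slope (v x) t r - slope ρ t r * v x t) (f := fun x => L x - β * v x t)
    (hnear.mono fun r hr => (si r (by linarith [hr.1])).sub ((i t ht).const_mul _))
    (hLi.sub ((i t ht).const_mul _))
    (hnear.mono fun r hr x => by
      have hrt : 0 < r - t / 2 := by linarith [hr.1]
      have htt : 0 < t - t / 2 := by linarith
      have hρr : 0 < ρ r := rpow_pos_of_pos (div_pos htt hrt) _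
      simp only [slope_def_field]
      rw [hρt, div_mul_eq_mul_div, ← sub_div]
      rcases lt_or_gt_of_ne hr.2 with h | h
      · have := hv.mul_le_of_le hp hk (s := t / 2) (by linarith) hr.1 h.le x
        refine div_nonneg_of_nonpos ?_ (by linarith)
        have e : ρ r * ((r - t / 2) / (t - t / 2)) ^ (1 / (p - 1)) = 1 := by
          simp only [hρ]
          rw [← mul_rpow (div_pos htt hrt).le (div_pos hrt htt).le, div_mul_div_cancel₀ hrt.ne',
            div_self htt.ne', one_rpow]
        have h3 := mul_le_mul_of_nonneg_left this hρr.le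
        rw [← mul_assoc, e, one_mul] at h3
        linarith
      · have : ρ r * v x t ≤ v x r :=
          hv.mul_le_of_le hp hk (s := t / 2) (by linarith) (by linarith) h.le x
        refine div_nonneg ?_ (by linarith)
        linarith)
    (fun x => (hasDerivAt_iff_tendsto_slope.1 (hv.pde x t ht)).sub (hβl.mul_const _))
    (by
      rw [integral_sub hLi ((i t ht).const_mul _), integral_const_mul, hv.mass t ht, hL0]
      refine (hβl.mul_const 1).const_sub 0 |>.congr' ?_
      filter_upwards [hnear] with r hr
      rw [integral_sub (si r (by linarith [hr.1])) ((i t ht).const_mul _), integral_const_mul,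
        hv.mass t ht, sint r (by linarith [hr.1])])
  have hlim := hS.add (hβl.sub_const β).abs
  rw [sub_self, abs_zero, add_zero] at hlim
  refine squeeze_zero' (Eventually.of_forall fun r => integral_nonneg fun x => abs_nonneg _) ?_ hlim
  filter_upwards [hnear] with r hr
  have hr0 : 0 < r := by linarith [hr.1]
  have i1 : Integrable fun x =>
      |slope (v x) t r - slope ρ t r * v x t - (L x - β * v x t)| := (((si r hr0).sub ((i t ht).const_mul (slope ρ t r))).sub
    (hLi.sub ((i t ht).const_mul β))).abs
  have i2 := (i t ht).const_mul |slope ρ t r - β|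
  calc ∫ x, |slope (v x) t r - L x|
      ≤ ∫ x, (|slope (v x) t r - slope ρ t r * v x t - (L x - β * v x t)| +
          |slope ρ t r - β| * v x t) := by
        refine integral_mono ((si r hr0).sub hLi).abs (i1.add i2) fun x => ?_
        beta_reduce
        rw [show slope (v x) t r - L x = (slope (v x) t r - slope ρ t r * v x t -
          (L x - β * v x t)) + (slope ρ t r - β) * v x t by ring]
        refine (abs_add_le _ _).trans (le_of_eq ?_)
        rw [abs_mul (slope ρ t r - β), abs_of_pos ((hv.tame t ht).pos x)]
    _ = _ := by
        rw [integral_add i1 i2, integral_const_mul, hv.mass t ht, mul_one]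

theorem eventually_le (hv : IsGlobalSol p k v) (hp : 1 < p)
    (hk : (n : ℝ) < k * (p - 1)) (ht : 0 < t) : ∃ M, ∀ᶠ r in 𝓝 t, ∀ x, v x r ≤ M := by
  obtain ⟨N, hN⟩ := (hv.tame (2 * t) (by linarith)).tame
  set c : ℝ := (1 / 6) ^ (1 / (p - 1))
  have hc : 0 < c := rpow_pos_of_pos (by norm_num) _
  refine ⟨N / c, ?_⟩
  filter_upwards [Ioo_mem_nhds (show 3 * t / 4 < t by linarith) (show t < 2 * t by linarith)]
    with r hr x
  have h1 := hv.mul_le_of_le hp hk (s := t / 2) (by linarith) (by linarith [hr.1]) hr.2.le x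
  have h2 := hN.le (hv.tame (2 * t) (by linarith)).pos x
  have h3 : c ≤ ((r - t / 2) / (2 * t - t / 2)) ^ (1 / (p - 1)) := by
    refine rpow_le_rpow (by norm_num) ?_ (one_div_nonneg.2 (by linarith))
    rw [div_le_div_iff₀ (by norm_num) (by linarith)]
    linarith [hr.1]
  have h4 := (hv.tame r (by linarith [hr.1])).pos x
  rw [le_div_iff₀ hc, mul_comm]
  exact (mul_le_mul_of_nonneg_right h3 h4.le).trans (h1.trans h2)

/-- The dissipation of `∫ v^p` along the flow. -/
theorem hasDerivAt_integral_rpow (hv : IsGlobalSol p k v) (hp : 1 < p)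
    (hk : (n : ℝ) < k * (p - 1)) (hvp : ∀ t > 0, Integrable fun x => v x t ^ p) (ht : 0 < t) :
    HasDerivAt (fun r => ∫ x, v x r ^ p)
      (-((p - 1) * ∫ x, ‖gradient (fun y => v y t ^ p) x‖ ^ 2 / v x t)) t := by
  have h := hv.tame t ht
  obtain ⟨N, hN⟩ := h.tame
  rw [← hN.integral_mul_lap_rpow h.smooth h.pos hp hk, hasDerivAt_iff_tendsto_slope]
  obtain ⟨M, hM⟩ := hv.eventually_le hp hk ht
  have hM0 : 0 ≤ M := (h.pos 0).le.trans (hM.self_of_nhds 0)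
  have hK : 0 ≤ p * M ^ (p - 1) := by positivity
  have hnear : ∀ᶠ r in 𝓝[≠] t, (0 < r ∧ ∀ x, v x r ≤ M) ∧ r ≠ t :=
    (((lt_mem_nhds ht).and hM).filter_mono nhdsWithin_le_nhds).and self_mem_nhdsWithin
  have hF : ∀ x, HasDerivAt (fun r => v x r ^ p)
      (p * v x t ^ (p - 1) * lap n (fun y => v y t ^ p) x) t := fun x =>
    ((hv.pde x t ht).rpow_const (Or.inl (h.pos x).ne')).congr_deriv (by ring)
  have key := tendsto_integral_of_abs_le (μ := volume) (l := 𝓝[≠] t)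
    (F := fun r x => slope (fun r => v x r ^ p) t r) (Q := fun r x => slope (v x) t r)
    (f := fun x => p * v x t ^ (p - 1) * lap n (fun y => v y t ^ p) x) hK
    (hnear.mono fun r hr => by
      simp_rw [slope_def_field]
      exact ((hvp r hr.1.1).sub (hvp t ht)).div_const _)
    (hnear.mono fun r hr => by
      simp_rw [slope_def_field]
      exact ((hv.tame r hr.1.1).integrable.sub h.integrable).div_const _)
    (h.integrable_lap hp hk)
    (hnear.mono fun r hr x => by
      simp_rw [slope_def_field, abs_div, ← mul_div_assoc]
      gcongr
      exact abs_rpow_sub_rpow_le hp ((hv.tame r hr.1.1).pos x).le (hr.1.2 x) (h.pos x).le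
        (hM.self_of_nhds x))
    (fun x => hasDerivAt_iff_tendsto_slope.1 (hF x))
    (fun x => by
      rw [abs_mul, abs_of_nonneg (mul_nonneg (by linarith) (rpow_nonneg (h.pos x).le _))]
      gcongr
      · exact (h.pos x).le
      · exact hM.self_of_nhds x)
    (hv.tendsto_integral_abs_slope_sub hp hk ht)
  refine key.congr' ?_
  filter_upwards [hnear] with r hr
  simp_rw [slope_def_field]
  rw [integral_div, integral_sub (hvp r hr.1.1) (hvp t ht)]

end IsGlobalSol

theorem setIntegral_pos_eq {n : ℕ} {f : EuclideanSpace ℝ (Fin n) → ℝ} (hf : ∀ x, 0 < f x)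
    (g : EuclideanSpace ℝ (Fin n) → ℝ) : ∫ x in {x | 0 < f x}, g x = ∫ x, g x := by
  rw [show {x | 0 < f x} = Set.univ from Set.eq_univ_of_forall hf, Measure.restrict_univ]

theorem IsGlobalSol.hasDerivAt_Rp {n k : ℕ} {p t : ℝ} {v : EuclideanSpace ℝ (Fin n) → ℝ → ℝ}
    (hv : IsGlobalSol p k v) (hp : 1 < p)
    (hk : (n : ℝ) < k * (p - 1)) (hvp : ∀ t > 0, Integrable fun x => v x t ^ p)
    (hvp0 : ∀ t > 0, 0 < ∫ x, v x t ^ p) (ht : 0 < t) :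
    HasDerivAt (fun s => Rp n p (fun x => v x s)) (fisherp n p (fun x => v x t)) t := by
  have h1 := ((hv.hasDerivAt_integral_rpow hp hk hvp ht).log (hvp0 t ht).ne').const_mul
    (1 / (1 - p))
  refine h1.congr_deriv ?_
  unfold fisherp
  rw [setIntegral_pos_eq (hv.tame t ht).pos]
  have := (hvp0 t ht).ne'
  have h2 : 1 - p ≠ 0 := by linarith
  field_simp
  ring

theorem hasDerivAt_norm_sq_line {n : ℕ} (i : Fin n) (x : EuclideanSpace ℝ (Fin n)) (s : ℝ) :
    HasDerivAt (fun s : ℝ => ‖x + s • EuclideanSpace.single i (1 : ℝ)‖ ^ 2) (2 * (x i + s)) s := by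
  have e : (fun s : ℝ => ‖x + s • EuclideanSpace.single i (1 : ℝ)‖ ^ 2) =
      fun s => ‖x‖ ^ 2 + 2 * (s * x i) + s ^ 2 := by
    funext s
    rw [norm_add_sq_real, inner_smul_right, norm_smul]
    simp [EuclideanSpace.inner_single_right]
  rw [e]
  refine (((((hasDerivAt_id s).mul_const (x i)).const_mul 2).const_add (‖x‖ ^ 2)).add
    ((hasDerivAt_id s).pow 2)).congr_deriv ?_
  simp
  ring

/-- The Laplacian of `u` at a point where `u` is touched from below by a multiple of the
power `‖x‖^(-2κ)`. -/
theorem mul_rpow_le_lap_of_isLocalMin {n : ℕ} {u : EuclideanSpace ℝ (Fin n) → ℝ} {A κ : ℝ}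
    {x : EuclideanSpace ℝ (Fin n)} (hu : ContDiff ℝ (⊤ : ℕ∞) u) (hx : x ≠ 0)
    (hmin : IsLocalMin (fun x => u x - A * (‖x‖ ^ 2) ^ (-κ)) x) :
    A * (2 * κ * (2 * κ + 2 - n) * (‖x‖ ^ 2) ^ (-κ - 1)) ≤ lap n u x := by
  have hr0 : 0 < ‖x‖ ^ 2 := by positivity
  have key : ∀ i : Fin n, A * (4 * κ * (κ + 1) * (‖x‖ ^ 2) ^ (-κ - 2) * x i ^ 2 -
      2 * κ * (‖x‖ ^ 2) ^ (-κ - 1)) ≤ pd i (pd i u) x := fun i => by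
    set γ : ℝ → EuclideanSpace ℝ (Fin n) := fun s => x + s • EuclideanSpace.single i (1 : ℝ) with hγ
    have hγ0 : γ 0 = x := by simp [hγ]
    have hγc : Continuous γ := by fun_prop
    have hr : ∀ s, HasDerivAt (fun s => ‖γ s‖ ^ 2) (2 * (x i + s)) s := hasDerivAt_norm_sq_line i x
    have hpos : ∀ᶠ s in 𝓝 (0 : ℝ), ‖γ s‖ ^ 2 ≠ 0 :=
      (hr 0).continuousAt.eventually_ne (by rw [hγ0]; exact hr0.ne')
    have d1 : ∀ᶠ s in 𝓝 (0 : ℝ), HasDerivAt (fun s => u (γ s) - A * (‖γ s‖ ^ 2) ^ (-κ))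
        (pd i u (γ s) - A * (2 * (x i + s) * -κ * (‖γ s‖ ^ 2) ^ (-κ - 1))) s := by
      filter_upwards [hpos] with s hs
      exact (hasDerivAt_comp_line i hu x s).sub (((hr s).rpow_const (Or.inl hs)).const_mul A)
    have d2 := (hasDerivAt_comp_line i (contDiff_pd i hu) x 0).sub
      (((((hasDerivAt_id (0 : ℝ)).const_add (x i)).const_mul 2).mul_const (-κ)).mul
        ((hr 0).rpow_const (p := -κ - 1) (Or.inl hpos.self_of_nhds)) |>.const_mul A)
    have := deriv_deriv_nonneg_of_isLocalMin d1 d2 (by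
      have h1 : Tendsto γ (𝓝 0) (𝓝 x) := by simpa [hγ0] using hγc.tendsto 0
      have h2 := h1.eventually hmin
      unfold IsLocalMin IsMinFilter
      beta_reduce
      rw [hγ0]
      exact h2)
    simp only [id, zero_smul, add_zero, hγ0, mul_one] at this
    rw [show -κ - 1 - 1 = -κ - 2 by ring] at this
    linarith
  rw [lap_eq_sum_pd hu]
  refine le_trans (le_of_eq ?_) (Finset.sum_le_sum fun i _ => key i)
  rw [← Finset.mul_sum, Finset.sum_sub_distrib, ← Finset.mul_sum, Finset.sum_const,
    ← EuclideanSpace.real_norm_sq_eq, Finset.card_univ, Fintype.card_fin, nsmul_eq_mul,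
    mul_assoc _ _ (‖x‖ ^ 2), ← rpow_add_one hr0.ne', show -κ - 2 + 1 = -κ - 1 by ring]
  ring

/-- At a positive time where a function attains its maximum over the past, its time derivative is
nonnegative. -/
theorem nonneg_of_hasDerivAt_of_forall_le {f : ℝ → ℝ} {s t f' : ℝ} (hst : s < t)
    (hf : HasDerivAt f f' t) (h : ∀ r ∈ Set.Ioo s t, f r ≤ f t) : 0 ≤ f' := by
  have h1 := (hasDerivAt_iff_tendsto_slope.1 hf).mono_left
    (nhdsWithin_mono (s := Set.Iio t) t (fun y hy => ne_of_lt hy))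
  refine ge_of_tendsto h1 ?_
  filter_upwards [Ioo_mem_nhdsLT hst] with r hr
  rw [slope_def_field]
  exact div_nonneg_of_nonpos (by linarith [h r hr]) (by linarith [hr.2])

/-- A family of functions depending continuously on a positive parameter, each of them Lipschitz,
is jointly continuous over some parameter interval. -/
theorem exists_continuousOn_Icc {α : Type*} [PseudoMetricSpace α] {v : α → ℝ → ℝ}
    (hc : ∀ x, ContinuousOn (v x) (Set.Ioi 0))
    (hL : ∀ t > 0, ∃ N, LipschitzWith N fun x => v x t) :
    ∃ s t : ℝ, 0 < s ∧ s < t ∧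
      ContinuousOn (fun z : α × ℝ => v z.1 z.2) (Set.univ ×ˢ Set.Icc s t) := by
  have : LocallyCompactSpace (Set.Ioi (0 : ℝ)) := isOpen_Ioi.locallyCompactSpace
  have : Nonempty (Set.Ioi (0 : ℝ)) := ⟨⟨1, Set.mem_Ioi.2 one_pos⟩⟩
  obtain ⟨N, z0, hz0⟩ := nonempty_interior_of_iUnion_of_closed
    (f := fun N : ℕ => {z : Set.Ioi (0 : ℝ) | LipschitzWith N fun x => v x z}) (fun N => by
      simp only [lipschitzWith_iff_dist_le_mul, Set.ofPred_forall]
      refine isClosed_iInter fun x => isClosed_iInter fun y => ?_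
      have c := fun x => continuousOn_iff_continuous_domRestrict.1 (hc x)
      exact isClosed_le ((c x).dist (c y)) continuous_const) (by
      refine Set.eq_univ_of_forall fun z => ?_
      obtain ⟨N, hN⟩ := hL z z.2
      obtain ⟨M, hM⟩ := exists_nat_ge N
      exact Set.mem_iUnion.2 ⟨M, hN.weaken hM⟩)
  rw [mem_interior_iff_mem_nhds, nhds_subtype, mem_comap] at hz0
  obtain ⟨O, hO, hOs⟩ := hz0
  obtain ⟨ε, hε, hball⟩ := Metric.mem_nhds_iff.1
    (inter_mem hO (isOpen_Ioi.mem_nhds z0.2 : Set.Ioi 0 ∈ 𝓝 (z0 : ℝ)))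
  have hsub : ∀ r ∈ Set.Icc (z0 : ℝ) (z0 + ε / 2), 0 < r ∧ LipschitzWith N fun x => v x r :=
    fun r hr => by
      have hr' : r ∈ Metric.ball (z0 : ℝ) ε := by
        rw [Metric.mem_ball, Real.dist_eq, abs_lt]
        constructor <;> linarith [hr.1, hr.2]
      exact ⟨(hball hr').2, hOs (show (⟨r, (hball hr').2⟩ : Set.Ioi (0 : ℝ)) ∈ _ from (hball hr').1)⟩
  exact ⟨z0, z0 + ε / 2, z0.2, by linarith, continuousOn_prod_of_continuousOn_lipschitzOnWith _ N
    (fun x _ => (hc x).mono fun r hr => (hsub r hr).1) fun r hr => (hsub r hr).2.lipschitzOnWith⟩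

section FastDiffusion

variable {n : ℕ} {p κ s t : ℝ} {v : EuclideanSpace ℝ (Fin n) → ℝ → ℝ}

/-- The barrier `(η (τ - s))^(1/(1-p)) ‖x‖^(-2κ/p)` gives an algebraic lower bound for
positive solutions of the fast diffusion equation. -/
theorem exists_mul_rpow_norm_le (hp : 0 < p) (hp1 : p < 1) (hst : s < t)
    (hsmooth : ∀ r ∈ Set.Icc s t, ContDiff ℝ (⊤ : ℕ∞) fun x => v x r)
    (hpos : ∀ r ∈ Set.Icc s t, ∀ x, 0 < v x r)
    (hpde : ∀ x, ∀ r ∈ Set.Icc s t, HasDerivAt (v x) (lap n (fun y => v y r ^ p) x) r)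
    (hcont : ContinuousOn (fun z : EuclideanSpace ℝ (Fin n) × ℝ => v z.1 z.2)
      (Set.univ ×ˢ Set.Icc s t))
    (hκ : 0 < κ) (hκn : 1 ≤ 2 * κ * (2 * κ + 2 - n)) (hκp : κ + 1 ≤ κ / p) :
    ∃ c > 0, ∀ x, 1 ≤ ‖x‖ → c * (‖x‖ ^ 2) ^ (-(κ / p)) ≤ v x t := by
  obtain ⟨m, hm, hmv⟩ := ((isCompact_sphere (0 : EuclideanSpace ℝ (Fin n)) 1).prod
    (isCompact_Icc (a := s) (b := t))).exists_forall_le' (hcont.mono (Set.prod_mono_left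
      (Set.subset_univ _))) (a := 0) fun z hz => hpos z.2 hz.2 z.1
  set α : ℝ := 1 / (1 - p) with hα
  have hp1' : 0 < 1 - p := by linarith
  have hα0 : 0 < α := one_div_pos.2 hp1'
  have hα1 : α - 1 = α * p := by rw [hα]; field_simp; ring
  have hcα : Continuous fun u : ℝ => u ^ α := continuous_rpow_const hα0.le
  obtain ⟨η, ⟨hηm, hη1⟩, hη0⟩ : ∃ η : ℝ, ((η * (t - s)) ^ α < m ∧ η < 1 - p) ∧ 0 < η := by
    have h1 : Tendsto (fun η : ℝ => (η * (t - s)) ^ α) (𝓝 0) (𝓝 0) := by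
      have h : Continuous fun η : ℝ => (η * (t - s)) ^ α := hcα.comp (by fun_prop)
      have := h.tendsto 0
      simpa [zero_rpow hα0.ne'] using this
    exact ((((h1.eventually (gt_mem_nhds hm)).and (gt_mem_nhds hp1')).filter_mono
      nhdsWithin_le_nhds).and (self_mem_nhdsWithin (s := Set.Ioi (0 : ℝ)))).exists
  set g : ℝ → ℝ := fun τ => (η * (τ - s)) ^ α with hg
  have hgc : Continuous g := hcα.comp (by fun_prop)
  have hle : ∀ τ ∈ Set.Icc s t, 0 ≤ η * (τ - s) := fun τ hτ =>
    mul_nonneg hη0.le (sub_nonneg.2 hτ.1)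
  have hg0 : ∀ τ ∈ Set.Icc s t, 0 ≤ g τ := fun τ hτ => rpow_nonneg (hle τ hτ) _
  have hgt : ∀ τ ∈ Set.Icc s t, g τ ≤ g t := fun τ hτ =>
    rpow_le_rpow (hle τ hτ) (mul_le_mul_of_nonneg_left (by linarith [hτ.2]) hη0.le) hα0.le
  have hgs : g s = 0 := by simp [hg, zero_rpow hα0.ne']
  have hgpos : ∀ τ, s < τ → 0 < g τ := fun τ hτ =>
    rpow_pos_of_pos (mul_pos hη0 (sub_pos.2 hτ)) _
  have hgd : ∀ τ, s < τ → ∃ g', HasDerivAt g g' τ ∧ 0 < g' ∧ g' ≤ g τ ^ p := fun τ hτ => by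
    have h0 : 0 < η * (τ - s) := mul_pos hη0 (sub_pos.2 hτ)
    have h1 : HasDerivAt (fun τ => η * (τ - s)) η τ := by
      simpa using ((hasDerivAt_id τ).sub_const s).const_mul η
    refine ⟨_, h1.rpow_const (Or.inl h0.ne'), by positivity, ?_⟩
    simp only [hg]
    rw [← rpow_mul h0.le, ← hα1]
    refine mul_le_of_le_one_left (rpow_nonneg h0.le _) ?_
    rw [hα, mul_one_div, div_le_one hp1']
    exact hη1.le
  have hw : ∀ τ ∈ Set.Icc s t, ∀ x : EuclideanSpace ℝ (Fin n),
      (g τ * (‖x‖ ^ 2) ^ (-(κ / p))) ^ p = g τ ^ p * (‖x‖ ^ 2) ^ (-κ) := fun τ hτ x => by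
    rw [mul_rpow (hg0 τ hτ) (by positivity), ← rpow_mul (sq_nonneg ‖x‖), neg_mul,
      div_mul_cancel₀ _ hp.ne']
  refine ⟨g t, hgpos t hst, fun x1 hx1 => ?_⟩
  by_contra! hlt
  have htt : t ∈ Set.Icc s t := ⟨hst.le, le_rfl⟩
  set F : EuclideanSpace ℝ (Fin n) × ℝ → ℝ :=
    fun z => g z.2 ^ p * (‖z.1‖ ^ 2) ^ (-κ) - v z.1 z.2 ^ p with hF
  have hδ : 0 < F (x1, t) := by
    have := rpow_lt_rpow (hpos t htt x1).le hlt hp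
    rw [hw t htt] at this
    exact sub_pos.2 this
  obtain ⟨ρ, hρ1, hρ⟩ : ∃ ρ : ℝ, ‖x1‖ ≤ ρ ∧ g t ^ p * (ρ ^ 2) ^ (-κ) < F (x1, t) := by
    have h1 := (((tendsto_rpow_neg_atTop hκ).comp
      (tendsto_pow_atTop (α := ℝ) two_ne_zero)).const_mul (g t ^ p))
    rw [mul_zero] at h1
    exact ((eventually_ge_atTop ‖x1‖).and (h1.eventually (gt_mem_nhds hδ))).exists
  set S : Set (EuclideanSpace ℝ (Fin n)) := Metric.closedBall 0 ρ ∩ {x | 1 ≤ ‖x‖} with hS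
  have hSc : IsCompact S := (isCompact_closedBall 0 ρ).inter_right
    (isClosed_le continuous_const continuous_norm)
  have hx1S : x1 ∈ S := ⟨by simpa using hρ1, hx1⟩
  have hFc : ContinuousOn F (S ×ˢ Set.Icc s t) := by
    refine ContinuousOn.sub (ContinuousOn.mul ?_ ?_) ?_
    · exact ((hgc.comp continuous_snd).rpow_const fun _ => Or.inr hp.le).continuousOn
    · refine ContinuousOn.rpow_const (by fun_prop) fun z hz => Or.inl ?_
      have : 0 < ‖z.1‖ := one_pos.trans_le hz.1.2
      positivity
    · exact (hcont.mono (Set.prod_mono_left (Set.subset_univ _))).rpow_const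
        fun z hz => Or.inr hp.le
  obtain ⟨⟨x, τ⟩, ⟨hxS, hτ⟩, hmax⟩ := (hSc.prod (isCompact_Icc (a := s) (b := t))).exists_isMaxOn
    ⟨(x1, t), hx1S, htt⟩ hFc
  simp only at hxS hτ
  have hge : F (x1, t) ≤ F (x, τ) := hmax ⟨hx1S, htt⟩
  have hx0 : 0 < ‖x‖ := one_pos.trans_le hxS.2
  have hvpos := hpos τ hτ x
  have hvp : 0 < v x τ ^ p := rpow_pos_of_pos hvpos p
  have hwv : v x τ < g τ * (‖x‖ ^ 2) ^ (-(κ / p)) := by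
    rw [← rpow_lt_rpow_iff hvpos.le (mul_nonneg (hg0 τ hτ) (by positivity)) hp, hw τ hτ]
    exact sub_pos.1 (hδ.trans_le hge)
  have hsτ : s < τ := by
    refine lt_of_le_of_ne hτ.1 fun h => ?_
    rw [← h, hgs, zero_mul] at hwv
    exact (hvpos.trans (h ▸ hwv)).false
  have hx1' : 1 < ‖x‖ := by
    refine lt_of_le_of_ne hxS.2 fun h => ?_
    rw [← h, one_pow, one_rpow, mul_one] at hwv
    exact (hwv.trans_le ((hgt τ hτ).trans hηm.le)).not_ge (hmv (x, τ) ⟨by simpa using h.symm, hτ⟩)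
  have hxρ : ‖x‖ < ρ := by
    refine lt_of_le_of_ne (by simpa using hxS.1) fun h => ?_
    have h1 : g τ ^ p * (‖x‖ ^ 2) ^ (-κ) ≤ g t ^ p * (ρ ^ 2) ^ (-κ) := by
      rw [h]
      exact mul_le_mul_of_nonneg_right (rpow_le_rpow (hg0 τ hτ) (hgt τ hτ) hp.le) (by positivity)
    have h2 : F (x, τ) = g τ ^ p * (‖x‖ ^ 2) ^ (-κ) - v x τ ^ p := rfl
    linarith
  have hlap := mul_rpow_le_lap_of_isLocalMin (κ := κ) (A := g τ ^ p)
    (contDiff_rpow_of_pos (hsmooth τ hτ) (hpos τ hτ) p) (norm_pos_iff.1 hx0) (by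
      have h1 : ∀ᶠ y in 𝓝 x, 1 < ‖y‖ ∧ ‖y‖ < ρ :=
        (continuous_norm.continuousAt.eventually_const_lt hx1').and
          (continuous_norm.continuousAt.eventually_lt_const hxρ)
      filter_upwards [h1] with y hy
      have : F (y, τ) ≤ F (x, τ) := hmax ⟨⟨by simpa using hy.2.le, hy.1.le⟩, hτ⟩
      simp only [hF] at this
      linarith)
  obtain ⟨g', hg', hg'0, hg'p⟩ := hgd τ hsτ
  have hr1 : 1 ≤ ‖x‖ ^ 2 := one_le_pow₀ hx1'.le
  set q := (‖x‖ ^ 2) ^ (-(κ / p)) with hq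
  have hq0 : 0 < q := by positivity
  have hwt : g' * q ≤ lap n (fun y => v y τ ^ p) x := by
    refine le_trans ?_ hlap
    have h1 : q ≤ 2 * κ * (2 * κ + 2 - n) * (‖x‖ ^ 2) ^ (-κ - 1) :=
      (rpow_le_rpow_of_exponent_le hr1 (by linarith)).trans
        (le_mul_of_one_le_left (by positivity) hκn)
    exact mul_le_mul hg'p h1 hq0.le (rpow_nonneg (hg0 τ hτ) _)
  have hFτ : HasDerivAt (fun r => (g r * q) ^ p - v x r ^ p)
      (g' * q * p * (g τ * q) ^ (p - 1) - lap n (fun y => v y τ ^ p) x * p * v x τ ^ (p - 1)) τ :=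
    ((hg'.mul_const q).rpow_const (Or.inl (hvpos.trans hwv).ne')).sub
      ((hpde x τ hτ).rpow_const (Or.inl hvpos.ne'))
  have h0 := nonneg_of_hasDerivAt_of_forall_le hsτ hFτ fun r hr => by
    have hr' : r ∈ Set.Icc s t := ⟨hr.1.le, hr.2.le.trans hτ.2⟩
    rw [hw r hr', hw τ hτ]
    exact hmax (⟨hxS, hr'⟩ : (x, r) ∈ S ×ˢ Set.Icc s t)
  have h1 : (g τ * q) ^ (p - 1) < v x τ ^ (p - 1) :=
    rpow_lt_rpow_of_neg hvpos hwv (by linarith)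
  have h2 : 0 < v x τ ^ (p - 1) := rpow_pos_of_pos hvpos _
  have h3 : 0 < g' * q * p := by positivity
  have h4 := mul_lt_mul_of_pos_left h1 h3
  have h5 := mul_le_mul_of_nonneg_right (mul_le_mul_of_nonneg_right hwt hp.le) h2.le
  linarith

/-- The fast diffusion equation has no positive solution decaying rapidly in space. -/
theorem false_of_lt_one (hn : 1 ≤ n) (hp : 0 < p) (hp1 : p < 1)
    (hsmooth : ∀ t > 0, ContDiff ℝ (⊤ : ℕ∞) fun x => v x t)
    (hpos : ∀ x, ∀ t > 0, 0 < v x t)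
    (hdecay : ∀ t > 0, ∀ k m : ℕ, ∃ C : ℝ, ∀ x,
      ‖x‖ ^ k * ‖iteratedFDeriv ℝ m (fun y => v y t) x‖ ≤ C)
    (hpde : ∀ x, ∀ t > 0, HasDerivAt (v x) (lap n (fun y => v y t ^ p) x) t) : False := by
  obtain ⟨s, t, hs, hst, hcont⟩ := exists_continuousOn_Icc (v := v)
    (fun x r hr => (hpde x r hr).continuousAt.continuousWithinAt) fun r hr => by
      obtain ⟨C, hC⟩ := hdecay r hr 0 1
      simp only [pow_zero, one_mul, norm_iteratedFDeriv_one] at hC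
      exact ⟨C.toNNReal, lipschitzWith_of_nnnorm_fderiv_le ((hsmooth r hr).differentiable (by simp))
        fun x => NNReal.le_toNNReal_of_coe_le (hC x)⟩
  have hp1' : 0 < 1 - p := by linarith
  have hn' : (1 : ℝ) ≤ n := by exact_mod_cast hn
  set κ : ℝ := max n (p / (1 - p)) with hκ
  have hκn : (n : ℝ) ≤ κ := le_max_left _ _
  have hκp : p / (1 - p) ≤ κ := le_max_right _ _
  obtain ⟨c, hc, hcv⟩ := exists_mul_rpow_norm_le (κ := κ) hp hp1 hst
    (fun r hr => hsmooth r (hs.trans_le hr.1)) (fun r hr x => hpos x r (hs.trans_le hr.1))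
    (fun x r hr => hpde x r (hs.trans_le hr.1)) hcont (by linarith) (by nlinarith) (by
      rw [div_le_iff₀ hp1'] at hκp
      rw [le_div_iff₀ hp]
      linarith)
  obtain ⟨k, hk⟩ := exists_nat_ge (2 * (κ / p) + 1)
  obtain ⟨C, hC⟩ := hdecay t (hs.trans hst) k 0
  simp only [norm_iteratedFDeriv_zero] at hC
  obtain ⟨R, hR1, hR⟩ : ∃ R : ℝ, 1 ≤ R ∧ C < c * R :=
    ((eventually_ge_atTop 1).and ((tendsto_id.const_mul_atTop hc).eventually_gt_atTop C)).exists
  have hR0 : 0 < R := by linarith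
  set x : EuclideanSpace ℝ (Fin n) := EuclideanSpace.single ⟨0, hn⟩ R with hx
  have hxR : ‖x‖ = R := by simp [hx, abs_of_pos hR0]
  have h1 := hcv x (hxR ▸ hR1)
  have h2 := (mul_le_mul_of_nonneg_left (le_abs_self (v x t)) (by positivity)).trans (hC x)
  rw [hxR] at h1 h2
  have h3 : R ≤ R ^ k * (R ^ 2) ^ (-(κ / p)) := by
    rw [← rpow_natCast R k, ← rpow_natCast R 2, ← rpow_mul hR0.le, ← rpow_add hR0]
    conv_lhs => rw [← rpow_one R]
    refine rpow_le_rpow_of_exponent_le hR1 ?_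
    push_cast
    linarith
  have h4 := mul_le_mul_of_nonneg_left h1 (pow_nonneg hR0.le k)
  have h5 := mul_le_mul_of_nonneg_left h3 hc.le
  linarith

end FastDiffusion

/-- **Generalized DeBruijn identity.**
Let `n ≥ 1`, `p > 0`, `p ≠ 1`, and let `v(x,t)` be a smooth, rapidly decaying positive
solution of `∂v/∂t = Δ(v^p)` on `ℝⁿ × (0,∞)` which is a probability density with finite
`∫ v^p > 0` and finite generalized Fisher information for every `t > 0`.  Then
`d/dt R_p(v(·,t)) = I_p(v(·,t))` for all `t > 0`; in particular `R_p(v(·,t))` is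
increasing in time. -/
theorem deBruijn_identity_renyi
    (n : ℕ) (hn : 1 ≤ n) (p : ℝ) (hp : 0 < p) (hp1 : p ≠ 1)
    (v : EuclideanSpace ℝ (Fin n) → ℝ → ℝ)
    (hsmooth : ∀ t > (0:ℝ), ContDiff ℝ (⊤ : ℕ∞) (fun x => v x t))
    (hpos : ∀ x, ∀ t > (0:ℝ), 0 < v x t)
    -- rapid decay: all space derivatives decay faster than any inverse power of ‖x‖
    (hdecay : ∀ t > (0:ℝ), ∀ k m : ℕ, ∃ Cc : ℝ, ∀ x,
      ‖x‖ ^ k * ‖iteratedFDeriv ℝ m (fun y => v y t) x‖ ≤ Cc)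
    (hpde : ∀ x, ∀ t > (0:ℝ), HasDerivAt (fun s => v x s) (lap n (fun y => v y t ^ p) x) t)
    (hint : ∀ t > (0:ℝ), Integrable fun x => v x t)
    (hmass : ∀ t > (0:ℝ), (∫ x, v x t) = 1)
    (hvp : ∀ t > (0:ℝ), Integrable fun x => v x t ^ p)
    (hvp0 : ∀ t > (0:ℝ), 0 < ∫ x, v x t ^ p)
    (hfish : ∀ t > (0:ℝ), IntegrableOn
      (fun x => ‖gradient (fun y => v y t ^ p) x‖ ^ 2 / v x t) {x | 0 < v x t}) :
    (∀ t > (0:ℝ), HasDerivAt (fun s => Rp n p (fun x => v x s))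
        (fisherp n p (fun x => v x t)) t) ∧
      MonotoneOn (fun t => Rp n p (fun x => v x t)) (Set.Ioi 0) := by
  have hpde' : ∀ x, ∀ t > 0, HasDerivAt (v x) (lap n (fun y => v y t ^ p) x) t := hpde
  rcases lt_or_gt_of_ne hp1 with h | h
  · exact (false_of_lt_one hn hp h hsmooth hpos hdecay hpde').elim
  obtain ⟨k, hk⟩ := exists_nat_gt (n / (p - 1))
  have hk : (n : ℝ) < k * (p - 1) := (div_lt_iff₀ (by linarith)).1 hk
  have hv : IsGlobalSol p k v :=
    ⟨fun t ht => ⟨hsmooth t ht, fun x => hpos x t ht,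
      TameBound.exists_of_decay (hsmooth t ht) k (hdecay t ht), hint t ht⟩, hpde', hmass⟩
  have hd := fun t (ht : 0 < t) => hv.hasDerivAt_Rp h hk hvp hvp0 ht
  refine ⟨hd, monotoneOn_of_deriv_nonneg (convex_Ioi 0)
    (fun t ht => (hd t ht).continuousAt.continuousWithinAt)
    (fun t ht => ?_) fun t ht => ?_⟩ <;> rw [interior_Ioi] at ht
  · exact (hd t ht).differentiableAt.differentiableWithinAt
  · rw [(hd t ht).deriv]
    exact mul_nonneg (inv_nonneg.2 (hvp0 t ht).le)
      (integral_nonneg fun x => div_nonneg (sq_nonneg _) (hpos x t ht).le)
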